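/- For every d ≥ 1 there exists a compact set S ⊆ ℝ^d of Hausdorff dimension exactly one such that every Lipschitz function g : ℝ^d → ℝ has a point of Fréchet differentiability in S; moreover the set of such differentiability points is dense in S. -/

import Mathlib

section
open MeasureTheory Set Metric
open scoped ENNReal NNReal

theorem mul_volume_le_of_forall_closedBall {g : ℝ → ℝ≥0∞} {E : Set ℝ} {R : ℝ} {c : ℝ≥0∞}
    (h : ∀ x ∈ E, ∃ r, 0 < r ∧ r ≤ R ∧
      c * ENNReal.ofReal r ≤ ∫⁻ y in closedBall x r, g y) :
    c * volume E ≤ 10 * ∫⁻ y, g y := by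
  choose! r hr0 hrR hr using h
  obtain ⟨u, huE, hdisj, hcov⟩ := Vitali.exists_disjoint_subfamily_covering_enlargement_closedBall
    E id r R hrR 5 (by norm_num)
  have hcount : u.Countable := by
    refine hdisj.countable_of_nonempty_interior fun x hx => ?_
    rw [interior_closedBall _ (hr0 x (huE hx)).ne']
    exact nonempty_ball.2 (hr0 x (huE hx))
  have hsub : E ⊆ ⋃ b ∈ u, closedBall b (5 * r b) := fun x hx => by
    obtain ⟨b, hb, hb'⟩ := hcov x hx
    exact mem_biUnion hb (hb' (mem_closedBall_self (hr0 x hx).le))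
  have := hcount.to_subtype
  calc c * volume E ≤ c * ∑' b : u, volume (closedBall (b : ℝ) (5 * r b)) := by
        gcongr
        exact (measure_mono hsub).trans (measure_biUnion_le _ hcount _)
    _ = ∑' b : u, 10 * (c * ENNReal.ofReal (r b)) := by
        rw [← ENNReal.tsum_mul_left]
        refine tsum_congr fun b => ?_
        rw [Real.volume_closedBall, show 2 * (5 * r b) = 10 * r b by ring,
          ENNReal.ofReal_mul (by norm_num)]
        simp only [ENNReal.ofReal_ofNat]
        ring
    _ ≤ ∑' b : u, 10 * ∫⁻ y in closedBall (b : ℝ) (r b), g y := by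
        gcongr with b
        exact hr b (huE b.2)
    _ = 10 * ∫⁻ y in ⋃ b ∈ u, closedBall b (r b), g y := by
        rw [ENNReal.tsum_mul_left, lintegral_biUnion (s := fun b => closedBall b (r b)) hcount
          (fun b _ => measurableSet_closedBall) hdisj]
    _ ≤ 10 * ∫⁻ y, g y := by
        gcongr
        exact Measure.restrict_le_self

/-- A truncated one-dimensional weak-type maximal inequality. -/
theorem mul_volume_le_of_forall_uIoc {g : ℝ → ℝ} (hg : Measurable g) {E : Set ℝ} {R c : ℝ}
    (hc : 0 ≤ c)
    (h : ∀ x ∈ E, ∃ y, x ≠ y ∧ |y - x| ≤ R ∧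
      ENNReal.ofReal (c * |y - x|) ≤ ∫⁻ t in uIoc x y, ENNReal.ofReal (g t)) :
    ENNReal.ofReal c * volume E ≤ 20 * ∫⁻ t in {t | c / 2 < g t}, ENNReal.ofReal (g t) := by
  have hm : MeasurableSet {t | c / 2 < g t} := measurableSet_lt measurable_const hg
  have key : ENNReal.ofReal (c / 2) * volume E ≤
      10 * ∫⁻ t, ({t | c / 2 < g t}).indicator (fun t => ENNReal.ofReal (g t)) t := by
    refine mul_volume_le_of_forall_closedBall (R := R) fun x hx => ?_
    obtain ⟨y, hxy, hR, hy⟩ := h x hx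
    refine ⟨|y - x|, abs_pos.2 (sub_ne_zero.2 hxy.symm), hR, ?_⟩
    have h1 : ∫⁻ t in uIoc x y, ENNReal.ofReal (g t) ≤
        (∫⁻ t in uIoc x y, ({t | c / 2 < g t}).indicator (fun t => ENNReal.ofReal (g t)) t) +
        ENNReal.ofReal (c / 2 * |y - x|) := by
      calc _ ≤ ∫⁻ t in uIoc x y, (({t | c / 2 < g t}).indicator
              (fun t => ENNReal.ofReal (g t)) t + ENNReal.ofReal (c / 2)) := by
            refine lintegral_mono fun t => ?_
            by_cases ht : c / 2 < g t
            · rw [indicator_of_mem (by exact ht)]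
              exact le_self_add
            · rw [indicator_of_notMem (by exact ht), zero_add]
              exact ENNReal.ofReal_le_ofReal (not_lt.1 ht)
        _ = _ := by
            rw [lintegral_add_right _ measurable_const, setLIntegral_const, Real.volume_uIoc,
              ENNReal.ofReal_mul (by positivity)]
    have h2 : ∫⁻ t in uIoc x y, ({t | c / 2 < g t}).indicator (fun t => ENNReal.ofReal (g t)) t ≤
        ∫⁻ t in closedBall x |y - x|,
          ({t | c / 2 < g t}).indicator (fun t => ENNReal.ofReal (g t)) t := by
      refine lintegral_mono_set fun t ht => ?_
      rw [mem_closedBall, Real.dist_eq]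
      exact abs_sub_left_of_mem_uIcc (uIoc_subset_uIcc ht)
    have h3 := (hy.trans h1).trans (add_le_add_left h2 _)
    rw [show c * |y - x| = c / 2 * |y - x| + c / 2 * |y - x| by ring,
      ENNReal.ofReal_add (by positivity) (by positivity)] at h3
    rw [← ENNReal.ofReal_mul (by positivity)]
    exact (ENNReal.add_le_add_iff_right ENNReal.ofReal_ne_top).1 h3
  rw [lintegral_indicator hm] at key
  calc ENNReal.ofReal c * volume E = 2 * (ENNReal.ofReal (c / 2) * volume E) := by
        rw [← mul_assoc, show (2 : ℝ≥0∞) = ENNReal.ofReal 2 by simp,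
          ← ENNReal.ofReal_mul (by norm_num)]
        congr 2; ring
    _ ≤ _ := by
        refine (mul_le_mul_right key 2).trans (le_of_eq ?_)
        rw [← mul_assoc]; norm_num

theorem lintegral_le_of_forall_uIoc {g h : ℝ → ℝ} (hg : Measurable g) (hg0 : ∀ t, 0 ≤ g t)
    (hh : Measurable h) {A : Set ℝ} (hA : MeasurableSet A) (hA0 : ∀ t ∈ A, 0 ≤ h t)
    {R K : ℝ} (hK : 0 < K)
    (H : ∀ x ∈ A, ∃ y, x ≠ y ∧ |y - x| ≤ R ∧
      ENNReal.ofReal (K * √(h x) * |y - x|) ≤ ∫⁻ t in uIoc x y, ENNReal.ofReal (g t)) :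
    ∫⁻ t in A, ENNReal.ofReal (h t) ≤
      ENNReal.ofReal (80 / K ^ 2) * ∫⁻ t, ENNReal.ofReal (g t ^ 2) := by
  set w : ℝ → ℝ := A.indicator fun t => √(h t) with hw
  have hwm : Measurable w := (hh.sqrt).indicator hA
  have hw0 : ∀ t, 0 ≤ w t := fun t => indicator_nonneg (fun _ _ => Real.sqrt_nonneg _) t
  have e1 : ∫⁻ t in A, ENNReal.ofReal (h t) = ∫⁻ t, ENNReal.ofReal (w t ^ (2 : ℝ)) := by
    rw [← lintegral_indicator hA]
    refine lintegral_congr fun t => ?_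
    by_cases ht : t ∈ A
    · simp only [hw, indicator_of_mem ht, Real.rpow_two]
      rw [Real.sq_sqrt (hA0 t ht)]
    · simp [hw, indicator_of_notMem ht]
  have e2 := lintegral_rpow_eq_lintegral_meas_lt_mul (volume : Measure ℝ)
    (Filter.Eventually.of_forall hw0) hwm.aemeasurable (p := 2) (by norm_num)
  set ν := (volume : Measure ℝ).withDensity fun t => ENNReal.ofReal (g t) with hν
  have hνa := lintegral_eq_lintegral_meas_lt ν (f := fun t => 2 / K * g t)
    (Filter.Eventually.of_forall fun t => by have := hg0 t; simp only [Pi.zero_apply]; positivity)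
    (by fun_prop)
  have b1 : ∀ v ∈ Ioi (0 : ℝ), volume {a | v < w a} * ENNReal.ofReal (v ^ ((2 : ℝ) - 1)) ≤
      ENNReal.ofReal (20 / K) * ν {a | v < 2 / K * g a} := by
    intro v hv
    have hv : 0 < v := hv
    have := mul_volume_le_of_forall_uIoc hg (E := {a | v < w a}) (R := R) (c := K * v)
      (by positivity) (fun x hx => by
        have hxA : x ∈ A := by
          by_contra hn
          have hx : v < w x := hx
          rw [hw, indicator_of_notMem hn] at hx
          exact absurd hx hv.not_gt
        obtain ⟨y, h1, h2, h3⟩ := H x hxA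
        refine ⟨y, h1, h2, le_trans (ENNReal.ofReal_le_ofReal ?_) h3⟩
        have hx : v < w x := hx
        rw [hw, indicator_of_mem hxA] at hx
        gcongr)
    have hset : {a | v < 2 / K * g a} = {t | K * v / 2 < g t} := by
      ext t
      simp only [mem_ofPred_eq]
      rw [div_mul_eq_mul_div, lt_div_iff₀ hK, div_lt_iff₀ (by norm_num : (0:ℝ) < 2)]
      constructor <;> intro h <;> linarith
    rw [hset, hν, withDensity_apply _ (measurableSet_lt measurable_const hg)]
    rw [show (2 : ℝ) - 1 = 1 by norm_num, Real.rpow_one]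
    rw [ENNReal.ofReal_mul hK.le, mul_assoc] at this
    rw [ENNReal.ofReal_div_of_pos hK, mul_comm (volume _), div_eq_mul_inv,
      mul_comm (ENNReal.ofReal 20), mul_assoc]
    rw [← ENNReal.mul_le_iff_le_inv (by simpa using hK) ENNReal.ofReal_ne_top]
    simpa using this
  rw [e1, e2]
  calc _ ≤ ENNReal.ofReal 2 * ∫⁻ v in Ioi (0 : ℝ),
        ENNReal.ofReal (20 / K) * ν {a | v < 2 / K * g a} := by
        gcongr ENNReal.ofReal 2 * ?_
        exact setLIntegral_mono' measurableSet_Ioi b1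
    _ = ENNReal.ofReal 2 * (ENNReal.ofReal (20 / K) *
        ∫⁻ t, ENNReal.ofReal (2 / K * g t) ∂ν) := by
        rw [hνa, lintegral_const_mul' _ _ ENNReal.ofReal_ne_top]
    _ = _ := by
        rw [hν, lintegral_withDensity_eq_lintegral_mul _ (by fun_prop) (by fun_prop),
          ← mul_assoc, ← ENNReal.ofReal_mul (by norm_num),
          ← lintegral_const_mul' _ _ ENNReal.ofReal_ne_top,
          ← lintegral_const_mul' _ _ ENNReal.ofReal_ne_top]
        refine lintegral_congr fun t => ?_
        have := hg0 t
        simp only [Pi.mul_apply]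
        rw [← ENNReal.ofReal_mul (hg0 t), ← ENNReal.ofReal_mul (by positivity),
          ← ENNReal.ofReal_mul (by positivity)]
        congr 1
        field_simp
        ring

theorem LipschitzWith.integral_deriv_eq_sub {f : ℝ → ℝ} {C : ℝ≥0} (hf : LipschitzWith C f)
    (a b : ℝ) : ∫ t in a..b, deriv f t = f b - f a :=
  (hf.lipschitzOnWith (s := uIcc a b)).absolutelyContinuousOnInterval.integral_deriv_eq_sub

/-- A Lipschitz function on `[-s, s]` which is far from being nearly decreasing on one half has,
away from the endpoints, a point where the derivative is not small and all difference quotients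
are controlled by its square root. -/
theorem LipschitzWith.exists_deriv_ge_forall_abs_sub_le {f : ℝ → ℝ} (hf : LipschitzWith 6 f)
    {s ω η : ℝ} (hω : 0 < ω) (hωs : ω < s) (hη : 0 < η)
    (H : 24 * ω + 4 * η * s - (f s - f (-s)) / 2 < max (f 0 - f (-s)) (f s - f 0)) :
    ∃ τ, |τ| < s - ω ∧ τ ≠ 0 ∧ η ≤ deriv f τ ∧
      ∀ τ' ∈ Icc (-s) s, |f τ' - f τ| ≤ 64 * √(deriv f τ) * |τ' - τ| := by
  by_contra! hcon
  have hs : 0 < s := hω.trans hωs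
  set h := deriv f with hh
  have hhm : Measurable h := measurable_deriv f
  have hb : ∀ t, |h t| ≤ 6 := fun t => by
    simpa using norm_deriv_le_of_lipschitz (x₀ := t) hf
  set J := Ioc (-s) s with hJ
  have hJm : MeasurableSet J := measurableSet_Ioc
  set A := {τ | |τ| < s - ω ∧ τ ≠ 0 ∧ η ≤ h τ} with hA
  have hAm : MeasurableSet A :=
    (measurableSet_lt (f := fun τ : ℝ => |τ|) (by fun_prop) measurable_const).inter
      ((measurableSet_singleton (0 : ℝ)).compl.inter (measurableSet_le measurable_const hhm))
  have hAJ : A ⊆ J := fun t ht => by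
    have := abs_lt.1 ht.1
    exact ⟨by linarith, by linarith⟩
  set g := J.indicator fun t => |h t| with hg
  have hgm : Measurable g := (hhm.abs).indicator hJm
  have hg0 : ∀ t, 0 ≤ g t := fun t => indicator_nonneg (fun _ _ => abs_nonneg _) t
  have hfin : ∀ S ⊆ J, volume S ≠ ⊤ := fun S hS =>
    ((measure_mono hS).trans_lt (by simp [hJ])).ne
  have h_integrable : ∀ {u : ℝ → ℝ} {C : ℝ}, Measurable u → (∀ t, |u t| ≤ C) → IntegrableOn u J :=
    fun hu hC => Measure.integrableOn_of_bounded (hfin J subset_rfl) hu.aestronglyMeasurable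
      (Filter.Eventually.of_forall hC)
  have hhi : IntegrableOn h J := h_integrable hhm hb
  have step := lintegral_le_of_forall_uIoc hgm hg0 hhm hAm (fun t ht => hη.le.trans ht.2.2)
    (R := 2 * s) (K := 64) (by norm_num) (fun x hx => by
      obtain ⟨y, hy, hlt⟩ := hcon x hx.1 hx.2.1 hx.2.2
      have hxJ := hAJ hx
      have hsub : uIoc x y ⊆ J := fun t ht => by
        rcases mem_uIoc.1 ht with h' | h'
        · exact ⟨hxJ.1.trans h'.1, h'.2.trans hy.2⟩
        · exact ⟨hy.1.trans_lt h'.1, h'.2.trans hxJ.2⟩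
      refine ⟨y, ?_, ?_, ?_⟩
      · rintro rfl
        simp at hlt
      · rw [abs_le]
        constructor <;> linarith [hxJ.1, hxJ.2, hy.1, hy.2]
      · refine (ENNReal.ofReal_le_ofReal hlt.le).trans ?_
        rw [← hf.integral_deriv_eq_sub x y, ← Real.norm_eq_abs,
          intervalIntegral.norm_intervalIntegral_eq, ofReal_norm]
        refine (enorm_integral_le_lintegral_enorm _).trans (le_of_eq ?_)
        refine setLIntegral_congr_fun measurableSet_uIoc fun t ht => ?_
        simp only [hg, indicator_of_mem (hsub ht)]
        rw [← Real.norm_eq_abs, ofReal_norm])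
  have stepR : ∫ t in A, h t ≤ 1 / 4 * ∫ t in J, |h t| := by
    have e1 : ENNReal.ofReal (∫ t in A, h t) = ∫⁻ t in A, ENNReal.ofReal (h t) :=
      ofReal_integral_eq_lintegral_ofReal (hhi.mono_set hAJ)
        ((ae_restrict_iff' hAm).2 (Filter.Eventually.of_forall fun t ht => hη.le.trans ht.2.2))
    have e2 : ENNReal.ofReal (∫ t in J, |h t|) = ∫⁻ t in J, ENNReal.ofReal |h t| :=
      ofReal_integral_eq_lintegral_ofReal hhi.abs
        (Filter.Eventually.of_forall fun t => abs_nonneg _)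
    have e3 : ∫⁻ t, ENNReal.ofReal (g t ^ 2) ≤
        ENNReal.ofReal 6 * ∫⁻ t in J, ENNReal.ofReal |h t| := by
      rw [← lintegral_indicator hJm, ← lintegral_const_mul' _ _ ENNReal.ofReal_ne_top]
      refine lintegral_mono fun t => ?_
      by_cases ht : t ∈ J
      · simp only [hg, indicator_of_mem ht]
        rw [← ENNReal.ofReal_mul (by norm_num)]
        refine ENNReal.ofReal_le_ofReal ?_
        nlinarith [hb t, abs_nonneg (h t)]
      · simp [hg, indicator_of_notMem ht]
    have e4 : ENNReal.ofReal (∫ t in A, h t) ≤ ENNReal.ofReal (1 / 4 * ∫ t in J, |h t|) := by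
      rw [e1, ENNReal.ofReal_mul (by norm_num), e2]
      refine step.trans ((mul_le_mul_right e3 _).trans ?_)
      rw [← mul_assoc, ← ENNReal.ofReal_mul (by norm_num)]
      gcongr
      norm_num
    exact (ENNReal.ofReal_le_ofReal_iff
      (mul_nonneg (by norm_num) (integral_nonneg fun t => abs_nonneg _))).1 e4
  set P := ∫ t in J, max (h t) 0 with hP
  have hpm : Measurable fun t => max (h t) 0 := hhm.max measurable_const
  have hpi : IntegrableOn (fun t => max (h t) 0) J := h_integrable hpm (C := 6) fun t => by
    rw [abs_of_nonneg (le_max_right _ _)]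
    exact max_le ((le_abs_self _).trans (hb t)) (by norm_num)
  have hD : ∫ t in J, h t = f s - f (-s) := by
    rw [← hf.integral_deriv_eq_sub, intervalIntegral.integral_of_le (by linarith)]
  have habs : ∫ t in J, |h t| = 2 * P - (f s - f (-s)) := by
    rw [← hD, hP, ← integral_const_mul, ← integral_sub (hpi.const_mul 2) hhi]
    refine integral_congr_ae (Filter.Eventually.of_forall fun t => ?_)
    rcases le_total (h t) 0 with h' | h'
    · simp [max_eq_right h', abs_of_nonpos h']
    · simp only [max_eq_left h', abs_of_nonneg h']; ring
  have hI : Ioo (-(s - ω)) (s - ω) ⊆ J := fun t ht => ⟨by linarith [ht.1], by linarith [ht.2]⟩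
  have hPle : P ≤ (∫ t in A, h t) + 12 * ω + 2 * η * s := by
    have hne : ∀ᵐ t ∂(volume.restrict J), t ≠ 0 :=
      ae_restrict_of_ae (Measure.ae_ne volume 0)
    have hAi : IntegrableOn (A.indicator h) J := hhi.indicator hAm
    have hci : IntegrableOn ((Ioo (-(s - ω)) (s - ω)).indicator fun _ => (6 : ℝ)) J :=
      (integrableOn_const (hfin J subset_rfl)).indicator measurableSet_Ioo
    have hki : IntegrableOn (fun _ => 6 + η) J := integrableOn_const (hfin J subset_rfl)
    have : P ≤ ∫ t in J, (A.indicator h t + (6 + η) -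
        (Ioo (-(s - ω)) (s - ω)).indicator (fun _ => (6 : ℝ)) t) := by
      refine integral_mono_ae hpi ((hAi.add hki).sub hci) ?_
      filter_upwards [hne] with t ht
      by_cases h1 : t ∈ Ioo (-(s - ω)) (s - ω)
      · rw [indicator_of_mem h1]
        by_cases h2 : η ≤ h t
        · rw [indicator_of_mem (show t ∈ A from ⟨abs_lt.2 h1, ht, h2⟩), max_eq_left (by linarith)]
          linarith
        · have : t ∉ A := fun h' => h2 h'.2.2
          rw [indicator_of_notMem this]
          have := max_le (not_le.1 h2).le hη.le
          linarith
      · have : t ∉ A := fun h' => h1 (abs_lt.1 h'.1)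
        rw [indicator_of_notMem h1, indicator_of_notMem this]
        have := max_le ((le_abs_self _).trans (hb t)) (by norm_num : (0 : ℝ) ≤ 6)
        linarith
    have hAk : IntegrableOn (fun t => A.indicator h t + (6 + η)) J := hAi.add hki
    rw [integral_sub hAk hci, integral_add hAi hki, setIntegral_indicator hAm,
      setIntegral_indicator measurableSet_Ioo, inter_eq_right.2 hAJ, inter_eq_right.2 hI,
      setIntegral_const, setIntegral_const, hJ, Real.volume_real_Ioc_of_le (by linarith),
      Real.volume_real_Ioo_of_le (by linarith)] at this
    simp only [smul_eq_mul] at this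
    nlinarith
  have hhalf : ∀ a b, a ≤ b → -s ≤ a → b ≤ s → f b - f a ≤ P := fun a b hab ha hb' => by
    rw [← hf.integral_deriv_eq_sub, intervalIntegral.integral_of_le hab]
    have hsub : Ioc a b ⊆ J := Ioc_subset_Ioc ha hb'
    refine (setIntegral_mono (hhi.mono_set hsub) (hpi.mono_set hsub)
      fun t => le_max_left _ _).trans ?_
    exact setIntegral_mono_set hpi (Filter.Eventually.of_forall fun t => le_max_right _ _)
      hsub.eventuallyLE
  have := max_le (hhalf (-s) 0 (by linarith) le_rfl hs.le) (hhalf 0 s hs.le (by linarith) le_rfl)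
  linarith

theorem LipschitzWith.abs_sub_le_norm {E : Type*} [NormedAddCommGroup E] {f : E → ℝ}
    (hf : LipschitzWith 1 f) (x y : E) : |f x - f y| ≤ ‖x - y‖ := by
  simpa [dist_eq_norm, Real.dist_eq] using hf.dist_le_mul x y

section BentPath
variable {E : Type*} [NormedAddCommGroup E] [NormedSpace ℝ E]

/-- The broken line through `q` with velocity `u` before time `0` and `w` afterwards. -/
noncomputable def bentPath (q u w : E) (τ : ℝ) : E := q + min τ 0 • u + max τ 0 • w

theorem bentPath_of_nonpos (q u w : E) {τ : ℝ} (h : τ ≤ 0) : bentPath q u w τ = q + τ • u := by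
  simp [bentPath, h]

theorem bentPath_of_nonneg (q u w : E) {τ : ℝ} (h : 0 ≤ τ) : bentPath q u w τ = q + τ • w := by
  simp [bentPath, h]

theorem norm_bentPath_sub_sub_le (q : E) {u w e : E} {κ : ℝ} (hu : ‖u - e‖ ≤ κ)
    (hw : ‖w - e‖ ≤ κ) (τ τ' : ℝ) :
    ‖bentPath q u w τ' - bentPath q u w τ - (τ' - τ) • e‖ ≤ κ * |τ' - τ| := by
  have h1 : bentPath q u w τ' - bentPath q u w τ - (τ' - τ) • e =
      (min τ' 0 - min τ 0) • (u - e) + (max τ' 0 - max τ 0) • (w - e) := by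
    have : τ' - τ = (min τ' 0 - min τ 0) + (max τ' 0 - max τ 0) := by
      linarith [min_add_max τ' 0, min_add_max τ 0]
    rw [this, bentPath, bentPath]
    module
  have h2 : |min τ' 0 - min τ 0| + |max τ' 0 - max τ 0| = |τ' - τ| := by
    rcases le_total τ' 0 with h | h <;> rcases le_total τ 0 with h' | h' <;>
      simp only [min_eq_left, min_eq_right, max_eq_left, max_eq_right, h, h'] <;>
      grind
  rw [h1, ← h2]
  refine (norm_add_le _ _).trans ?_
  rw [norm_smul, norm_smul, Real.norm_eq_abs, Real.norm_eq_abs, mul_add, mul_comm κ, mul_comm κ]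
  gcongr

theorem norm_bentPath_sub_le (q : E) {u w : E} {κ : ℝ} (hu : ‖u‖ ≤ κ) (hw : ‖w‖ ≤ κ) (τ τ' : ℝ) :
    ‖bentPath q u w τ' - bentPath q u w τ‖ ≤ κ * |τ' - τ| := by
  simpa using norm_bentPath_sub_sub_le q (e := 0) (by simpa using hu) (by simpa using hw) τ τ'

end BentPath

section Pairs
variable {E : Type*} [NormedAddCommGroup E] [InnerProductSpace ℝ E]

/-- A point, a direction, and a candidate for the derivative at the point in that direction. -/
structure DirPair (E : Type*) where
  pt : E
  dir : E
  slope : ℝ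

/-- The perturbed slope which is almost maximized in the construction. -/
noncomputable def DirPair.gauge (c : ℝ) (y : E) (z : DirPair E) : ℝ :=
  z.slope - c / 2 * ‖z.dir‖ ^ 2 + inner ℝ y z.dir

/-- The pairs competing with the given pair. -/
structure IsAdmissible (f : E → ℝ) (T : ℝ → Set E) (c θ : ℝ) (y : E) (μ δ Δ : ℝ)
    (z z' : DirPair E) : Prop where
  hasLineDerivAt : HasLineDerivAt ℝ f z'.slope z'.pt z'.dir
  mem : ∃ l, 0 < l ∧ l < μ ∧ z'.pt ∈ T l
  near : ‖z'.pt - z.pt‖ < δ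
  gauge_le : z.gauge c y ≤ z'.gauge c y
  abs_slope_le : ∃ α > 0, ∀ t, |t| ≤ Δ → |f (z'.pt + t • z.dir) - f z'.pt - z.slope * t| ≤
    (θ - α + 64 * √(z'.gauge c y - z.gauge c y)) * |t|

/-- Near a point of `T l`, broken lines with two pieces can be approximated inside `T l'`. -/
def HasBrokenLines (T : ℝ → Set E) : Prop :=
  ∀ l l', 0 < l → l < l' → l' < 1 → ∀ x ∈ T l, ∀ ζ > 0, ∃ s₀ > 0, ∀ s, 0 < s → s < s₀ →
    ∀ p₁ ∈ Metric.closedBall x (2 * s), ∀ p₂ ∈ Metric.closedBall x (2 * s),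
    ∀ p₃ ∈ Metric.closedBall x (2 * s), ∃ q₁ q₂ q₃, ‖q₁ - p₁‖ ≤ ζ * s ∧ ‖q₂ - p₂‖ ≤ ζ * s ∧
      ‖q₃ - p₃‖ ≤ ζ * s ∧ segment ℝ q₁ q₂ ⊆ T l' ∧ segment ℝ q₂ q₃ ⊆ T l'

theorem HasLineDerivAt.exists_abs_sub_le {f : E → ℝ} {x e : E} {a σ : ℝ}
    (h : HasLineDerivAt ℝ f a x e) (hσ : 0 < σ) :
    ∃ ρ > 0, ∀ t, |t| ≤ ρ → |f (x + t • e) - f x - a * t| ≤ σ * |t| := by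
  have h1 := (hasDerivAt_iff_isLittleO.1 h).def hσ
  obtain ⟨ρ, hρ, h2⟩ := Metric.eventually_nhds_iff.1 h1
  refine ⟨ρ / 2, half_pos hρ, fun t ht => ?_⟩
  have := h2 (y := t) (by rw [Real.dist_eq, sub_zero]; linarith)
  simpa [mul_comm] using this

theorem sub_gauge_sub (c : ℝ) (y e e' : E) :
    (c / 2 * ‖e'‖ ^ 2 - inner ℝ y e') - (c / 2 * ‖e‖ ^ 2 - inner ℝ y e) =
      inner ℝ (c • e - y) (e' - e) + c / 2 * ‖e' - e‖ ^ 2 := by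
  simp only [← real_inner_self_eq_norm_sq, inner_sub_left, inner_sub_right, real_inner_smul_left,
    real_inner_comm e e']
  ring

theorem tilt_gauge_bounds {c D s : ℝ} {y e b v' : E} (hc0 : 0 ≤ c) (hc : c ≤ 2) (hy : ‖y‖ ≤ 2)
    (he : ‖e‖ ≤ 2) (hD0 : 0 < D) (hD : D ≤ 1 / 100) (hs0 : 0 < s) (hv' : ‖v'‖ = D * s)
    (hb : ‖s • (b - e) - v'‖ ≤ 2 * (D ^ 3 * s)) :
    ‖b - e‖ ≤ 11 / 10 * D ∧
      s * ((c / 2 * ‖b‖ ^ 2 - inner ℝ y b) - (c / 2 * ‖e‖ ^ 2 - inner ℝ y e)) ≤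
        inner ℝ (c • e - y) v' + 3 / 2 * D ^ 2 * s ∧
      |(c / 2 * ‖b‖ ^ 2 - inner ℝ y b) - (c / 2 * ‖e‖ ^ 2 - inner ℝ y e)| ≤ 7 * D := by
  have hD2 : D ^ 3 ≤ D ^ 2 / 100 := by nlinarith [sq_nonneg D]
  have hD3 : D ^ 2 ≤ D / 100 := by nlinarith
  have hp : ‖c • e - y‖ ≤ 6 := by
    refine (norm_sub_le _ _).trans ?_
    rw [norm_smul, Real.norm_eq_abs, abs_of_nonneg hc0]
    nlinarith [norm_nonneg e]
  have hbe : ‖b - e‖ ≤ D + 2 * D ^ 3 := by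
    have h1 : s * ‖b - e‖ = ‖s • (b - e)‖ := by
      rw [norm_smul, Real.norm_eq_abs, abs_of_pos hs0]
    have h2 : ‖s • (b - e)‖ ≤ ‖s • (b - e) - v'‖ + ‖v'‖ := by
      simpa using norm_add_le (s • (b - e) - v') v'
    refine le_of_mul_le_mul_left ?_ hs0
    rw [h1]
    linarith
  have hbe' : ‖b - e‖ ≤ 10003 / 10000 * D := by
    have : D ^ 3 ≤ D / 10000 := by linarith
    linarith
  have hsq : ‖b - e‖ ^ 2 ≤ (10003 / 10000 * D) ^ 2 := by gcongr
  rw [sub_gauge_sub]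
  refine ⟨by linarith, ?_, ?_⟩
  · have h1 : s * inner ℝ (c • e - y) (b - e) =
        inner ℝ (c • e - y) v' + inner ℝ (c • e - y) (s • (b - e) - v') := by
      rw [← inner_add_right, add_sub_cancel, real_inner_smul_right]
    have h2 : inner ℝ (c • e - y) (s • (b - e) - v') ≤ 6 * (2 * (D ^ 3 * s)) :=
      (real_inner_le_norm _ _).trans (by gcongr)
    rw [mul_add, h1]
    have h3 : s * (c / 2 * ‖b - e‖ ^ 2) ≤ s * (10003 / 10000 * D) ^ 2 := by
      gcongr
      nlinarith [sq_nonneg ‖b - e‖]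
    nlinarith
  · have h1 : |inner ℝ (c • e - y) (b - e)| ≤ 6 * (10003 / 10000 * D) :=
      (abs_real_inner_le_norm _ _).trans (by gcongr)
    have h2 : |c / 2 * ‖b - e‖ ^ 2| ≤ (10003 / 10000 * D) ^ 2 := by
      rw [abs_of_nonneg (by positivity)]
      nlinarith [sq_nonneg ‖b - e‖]
    refine (abs_add_le _ _).trans ?_
    nlinarith

set_option maxHeartbeats 1600000 in
theorem IsAdmissible.exists_forall_abs_sub_inner_le {f : E → ℝ} (hf : LipschitzWith 1 f)
    {T : ℝ → Set E} (hT : HasBrokenLines T) {c D ε κ : ℝ} {y : E} {μ δ Δ : ℝ} {z z' : DirPair E}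
    (hμ : μ < 1) (hc0 : 0 ≤ c) (hc : c ≤ 2) (hy : ‖y‖ ≤ 2) (he : ‖z'.dir‖ ≤ 2)
    (ha : |z'.slope| ≤ 2) (hz : IsAdmissible f T c (64 * D) y μ δ Δ z z')
    (hmax : ∀ w, IsAdmissible f T c (64 * D) y μ δ Δ z w → w.gauge c y ≤ z'.gauge c y + κ)
    (hclose : ‖z'.dir - z.dir‖ + |z'.slope - z.slope| ≤ 4 * D)
    (hD0 : 0 < D) (hD : D ≤ 1 / 100) (hDε : 56 * D < ε) (hκ : κ < ε * D / 8) :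
    ∃ r > 0, ∀ v, ‖v‖ < r →
      |f (z'.pt + v) - f z'.pt - inner ℝ (c • z'.dir - y) v| ≤ ε * ‖v‖ := by
  obtain ⟨hder, ⟨l, hl0, hlμ, hxl⟩, hnear, hG, β₀, hβ₀, hslope⟩ := hz
  obtain ⟨x, e, a⟩ := z'
  obtain ⟨xn, en, an⟩ := z
  dsimp only at *
  set z' : DirPair E := ⟨x, e, a⟩ with hz'
  set z : DirPair E := ⟨xn, en, an⟩ with hz
  obtain ⟨l', hll', hl'μ⟩ := exists_between hlμ
  set β := min β₀ (64 * D) with hβ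
  have hβ0 : 0 < β := lt_min hβ₀ (by positivity)
  have hβD : β ≤ 64 * D := min_le_right _ _
  have hε0 : 0 < ε := by linarith
  obtain ⟨s₀, hs₀, hstar⟩ := hT l l' hl0 hll' (hl'μ.trans hμ) x hxl (D ^ 3) (by positivity)
  obtain ⟨ρ, hρ, hρd⟩ := hder.exists_abs_sub_le (σ := D ^ 3) (by positivity)
  set S := min (min s₀ (ρ / 2)) (min ((δ - ‖x - xn‖) / 3) (β * (ρ / 2) / 12)) with hS
  have hS0 : 0 < S := by
    refine lt_min (lt_min hs₀ (by positivity)) (lt_min ?_ (by positivity))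
    linarith
  refine ⟨D * S, by positivity, fun v hv => ?_⟩
  by_contra! hbad
  have hr : 0 < ‖v‖ := by
    rw [norm_pos_iff]
    rintro rfl
    simp at hbad
  set s := ‖v‖ / D with hs
  have hsv : ‖v‖ = D * s := by rw [hs]; field_simp
  have hs0 : 0 < s := by positivity
  have hsS : s < S := by
    rw [hsv] at hv
    exact lt_of_mul_lt_mul_left hv hD0.le
  obtain ⟨⟨hs1, hs2⟩, hs3, hs4⟩ : (s < s₀ ∧ s < ρ / 2) ∧ s < (δ - ‖x - xn‖) / 3 ∧
      s < β * (ρ / 2) / 12 := by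
    simpa [hS] using hsS
  obtain ⟨q₁, q₂, q₃, hq1, hq2, hq3, hseg1, hseg2⟩ := hstar s hs0 hs1 (x - s • e)
    (by
      rw [mem_closedBall_iff_norm, sub_sub_cancel_left, norm_neg, norm_smul, Real.norm_eq_abs,
        abs_of_pos hs0]
      nlinarith) (x + v)
    (by rw [mem_closedBall_iff_norm, add_sub_cancel_left, hsv]; nlinarith) (x + s • e)
    (by
      rw [mem_closedBall_iff_norm, add_sub_cancel_left, norm_smul, Real.norm_eq_abs,
        abs_of_pos hs0]
      nlinarith)
  have hD2 : D ^ 3 ≤ D ^ 2 / 100 := by nlinarith [sq_nonneg D]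
  have hD3 : D ^ 2 ≤ D / 100 := by nlinarith
  set u := s⁻¹ • (q₂ - q₁) with hu
  set w := s⁻¹ • (q₃ - q₂) with hw
  have hsu : s • u = q₂ - q₁ := by rw [hu, smul_inv_smul₀ hs0.ne']
  have hsw : s • w = q₃ - q₂ := by rw [hw, smul_inv_smul₀ hs0.ne']
  have hu' : s • (u - e) - v = (q₂ - (x + v)) - (q₁ - (x - s • e)) := by
    rw [smul_sub, hsu]; abel
  have hw' : s • (w - e) - (-v) = (q₃ - (x + s • e)) - (q₂ - (x + v)) := by
    rw [smul_sub, hsw]; abel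
  have hqq : ∀ {m m' : E}, ‖m‖ ≤ D ^ 3 * s → ‖m'‖ ≤ D ^ 3 * s → ‖m - m'‖ ≤ 2 * (D ^ 3 * s) :=
    fun h1 h2 => (norm_sub_le _ _).trans (by linarith)
  obtain ⟨hue, hus, hua⟩ := tilt_gauge_bounds (b := u) hc0 hc hy he hD0 hD hs0 hsv
    (by rw [hu']; exact hqq hq2 hq1)
  obtain ⟨hwe, hws, hwa⟩ :=
    tilt_gauge_bounds (b := w) (v' := -v) hc0 hc hy he hD0 hD hs0 (by rw [norm_neg, hsv])
      (by rw [hw']; exact hqq hq3 hq2)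
  set P : E → ℝ := fun b => (c / 2 * ‖b‖ ^ 2 - inner ℝ y b) - (c / 2 * ‖e‖ ^ 2 - inner ℝ y e)
    with hP
  change s * P u ≤ _ at hus
  change |P u| ≤ _ at hua
  change s * P w ≤ _ at hws
  change |P w| ≤ _ at hwa
  set γ := bentPath q₂ u w with hγ
  set Q := bentPath 0 (P u) (P w) with hQ
  set φ : ℝ → ℝ := fun τ => f (γ τ) - a * τ - Q τ with hφ
  have hun : ‖u‖ ≤ 21 / 10 := by
    have := norm_add_le (u - e) e
    rw [sub_add_cancel] at this
    linarith
  have hwn : ‖w‖ ≤ 21 / 10 := by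
    have := norm_add_le (w - e) e
    rw [sub_add_cancel] at this
    linarith
  have hQL : ∀ τ τ', |Q τ' - Q τ| ≤ 7 * D * |τ' - τ| := fun τ τ' => by
    simpa using norm_bentPath_sub_le (0 : ℝ) (u := P u) (w := P w) (by simpa using hua)
      (by simpa using hwa) τ τ'
  have hφL : LipschitzWith 6 φ := by
    refine LipschitzWith.of_dist_le_mul fun τ' τ => ?_
    rw [Real.dist_eq, Real.dist_eq, NNReal.coe_ofNat]
    have h1 := (hf.abs_sub_le_norm (γ τ') (γ τ)).trans (norm_bentPath_sub_le q₂ hun hwn τ τ')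
    have h2 := hQL τ τ'
    have h3 : |a * (τ' - τ)| ≤ 2 * |τ' - τ| := by rw [abs_mul]; gcongr
    have h4 : φ τ' - φ τ = (f (γ τ') - f (γ τ)) - a * (τ' - τ) - (Q τ' - Q τ) := by
      simp only [hφ]; ring
    rw [h4]
    have h5 : D * |τ' - τ| ≤ 1 / 100 * |τ' - τ| := by gcongr
    refine (abs_sub _ _).trans ((add_le_add_left (abs_sub _ _) _).trans ?_)
    linarith [abs_nonneg (τ' - τ)]
  have γ0 : γ 0 = q₂ := by simp [hγ, bentPath]
  have γs : γ s = q₃ := by rw [hγ, bentPath_of_nonneg _ _ _ hs0.le, hsw]; abel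
  have γs' : γ (-s) = q₁ := by
    rw [hγ, bentPath_of_nonpos _ _ _ (by linarith), neg_smul, hsu]; abel
  have φ0 : φ 0 = f q₂ := by simp [hφ, γ0, hQ, bentPath]
  have φs : φ s = f q₃ - a * s - s * P w := by
    simp [hφ, γs, hQ, bentPath_of_nonneg _ _ _ hs0.le]
  have φs' : φ (-s) = f q₁ + a * s + s * P u := by
    simp [hφ, γs', hQ, bentPath_of_nonpos _ _ _ (show -s ≤ 0 by linarith)]
  have d1 := abs_le.1 ((hf.abs_sub_le_norm _ _).trans hq1)
  have d2 := abs_le.1 ((hf.abs_sub_le_norm _ _).trans hq2)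
  have d3 := abs_le.1 ((hf.abs_sub_le_norm _ _).trans hq3)
  have d4 := abs_le.1 (hρd s (by rw [abs_of_pos hs0]; linarith))
  have d5 := abs_le.1 (hρd (-s) (by rw [abs_neg, abs_of_pos hs0]; linarith))
  rw [abs_of_pos hs0] at d4
  rw [abs_neg, abs_of_pos hs0, neg_smul, ← sub_eq_add_neg] at d5
  rw [inner_neg_right] at hws
  have hD3s : D ^ 3 * s ≤ D ^ 2 * s / 100 := by
    rw [← div_mul_eq_mul_div]; gcongr
  have hDs : D * s ≤ s / 100 := by
    rw [div_eq_inv_mul]; gcongr; linarith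
  have hD2s : 0 < D ^ 2 * s := by positivity
  have hD2s' : D ^ 2 * s ≤ D * s / 100 := by
    rw [← div_mul_eq_mul_div]; gcongr
  have i1 : f (x + v) - f x - inner ℝ (c • e - y) v - 2 * D ^ 2 * s ≤ φ 0 - φ (-s) := by
    rw [φ0, φs']; linarith
  have i2 : -(f (x + v) - f x - inner ℝ (c • e - y) v) - 2 * D ^ 2 * s ≤ φ s - φ 0 := by
    rw [φ0, φs]; linarith
  obtain ⟨τ, hτs, hτ0, hτη, hτ⟩ := hφL.exists_deriv_ge_forall_abs_sub_le (s := s)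
    (ω := D ^ 2 * s) (η := ε * D / 8) hD2s (by linarith) (by positivity) (by
      have e1 : 28 * D ^ 2 * s < ε * D / 2 * s := by
        have : 56 * D * D < ε * D := by gcongr
        gcongr
        linarith
      rw [hsv] at hbad
      rcases lt_abs.1 hbad with h | h
      · refine lt_of_lt_of_le ?_ (le_max_left _ _)
        linarith
      · refine lt_of_lt_of_le ?_ (le_max_right _ _)
        linarith)
  set h := deriv φ τ with hh
  have hh0 : 0 < h := lt_of_lt_of_le (by positivity) hτη
  have hτs2 : |τ| < s := by linarith
  have hφd : HasDerivAt φ h τ := (differentiableAt_of_deriv_ne_zero hh0.ne').hasDerivAt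
  obtain ⟨b, hb1, hb2, hb3⟩ : ∃ b, HasLineDerivAt ℝ f (h + a + P b) (γ τ) b ∧ γ τ ∈ T l' ∧
      ‖γ τ - (x + τ • e)‖ ≤ D ^ 3 * s + 11 / 10 * D * (s - |τ|) := by
    have hφd' : HasDerivAt (fun t => φ (τ + t)) h 0 := by
      have : HasDerivAt φ h (τ + 0) := by simpa using hφd
      simpa using this.comp_const_add τ 0
    have base : ∀ (b : E) (π : ℝ), (∀ᶠ t in nhds (0 : ℝ), γ (τ + t) = γ τ + t • b ∧
        Q (τ + t) = Q τ + t * π) → HasLineDerivAt ℝ f (h + a + π) (γ τ) b := by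
      intro b π hev
      have hlin : HasDerivAt (fun t => a * (τ + t) + (Q τ + t * π)) (a + π) 0 := by
        have h1 : HasDerivAt (fun t : ℝ => a * (τ + t)) (a * 1) 0 :=
          ((hasDerivAt_id (0 : ℝ)).const_add τ).const_mul a
        have h2 : HasDerivAt (fun t : ℝ => Q τ + t * π) (1 * π) 0 :=
          ((hasDerivAt_id (0 : ℝ)).mul_const π).const_add (Q τ)
        simpa using h1.fun_add h2
      have := hφd'.add hlin
      rw [← add_assoc] at this
      refine this.congr_of_eventuallyEq ?_
      filter_upwards [hev] with t ht
      simp only [Pi.add_apply, hφ, ht.1, ht.2]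
      ring
    rcases lt_or_gt_of_ne hτ0 with hneg | hpos
    · refine ⟨u, base u (P u) ?_, hseg1 ?_, ?_⟩
      · have : ∀ᶠ t in nhds (0 : ℝ), t < -τ := eventually_lt_nhds (by linarith)
        filter_upwards [this] with t ht
        rw [hγ, hQ, bentPath_of_nonpos _ _ _ (by linarith), bentPath_of_nonpos _ _ _ hneg.le,
          bentPath_of_nonpos _ _ _ (by linarith), bentPath_of_nonpos _ _ _ hneg.le]
        refine ⟨by module, by simp only [smul_eq_mul]; ring⟩
      · rw [hγ, bentPath_of_nonpos _ _ _ hneg.le]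
        rw [abs_of_neg hneg] at hτs2
        have hτs' : -τ / s ≤ 1 := by rw [div_le_one hs0]; exact hτs2.le
        refine ⟨-τ / s, 1 - -τ / s, div_nonneg (by linarith) hs0.le, by linarith, by ring, ?_⟩
        rw [hu, smul_smul, ← div_eq_mul_inv, neg_div]
        module
      · have : γ τ - (x + τ • e) = (q₁ - (x - s • e)) + (s + τ) • (u - e) := by
          rw [hγ, bentPath_of_nonpos _ _ _ hneg.le, smul_sub, add_smul, hsu]
          module
        rw [this]
        rw [abs_of_neg hneg] at hτs2 ⊢
        refine (norm_add_le _ _).trans (add_le_add hq1 ?_)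
        have : 0 ≤ s + τ := by linarith
        rw [norm_smul, Real.norm_eq_abs, abs_of_nonneg this, mul_comm]
        rw [sub_neg_eq_add]
        gcongr
    · refine ⟨w, base w (P w) ?_, hseg2 ?_, ?_⟩
      · have : ∀ᶠ t in nhds (0 : ℝ), -τ < t := eventually_gt_nhds (by linarith)
        filter_upwards [this] with t ht
        rw [hγ, hQ, bentPath_of_nonneg _ _ _ (by linarith), bentPath_of_nonneg _ _ _ hpos.le,
          bentPath_of_nonneg _ _ _ (by linarith), bentPath_of_nonneg _ _ _ hpos.le]
        refine ⟨by module, by simp only [smul_eq_mul]; ring⟩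
      · rw [hγ, bentPath_of_nonneg _ _ _ hpos.le]
        rw [abs_of_pos hpos] at hτs2
        have hτs' : τ / s ≤ 1 := by rw [div_le_one hs0]; exact hτs2.le
        refine ⟨1 - τ / s, τ / s, by linarith, div_nonneg (by linarith) hs0.le, by ring, ?_⟩
        rw [hw, smul_smul, ← div_eq_mul_inv]
        module
      · have : γ τ - (x + τ • e) = (q₃ - (x + s • e)) - (s - τ) • (w - e) := by
          rw [hγ, bentPath_of_nonneg _ _ _ hpos.le, smul_sub, sub_smul, hsw]
          module
        rw [this]
        rw [abs_of_pos hpos] at hτs2 ⊢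
        refine (norm_sub_le _ _).trans (add_le_add hq3 ?_)
        have : 0 ≤ s - τ := by linarith
        rw [norm_smul, Real.norm_eq_abs, abs_of_nonneg this, mul_comm]
        gcongr
  set z'' : DirPair E := ⟨γ τ, b, h + a + P b⟩ with hz''
  have hgz : z''.gauge c y = z'.gauge c y + h := by
    simp only [DirPair.gauge, hz', hz'', hP]; ring
  have hγx : ‖γ τ - x‖ ≤ 3 * s := by
    have h1 := norm_bentPath_sub_le q₂ hun hwn 0 τ
    rw [← hγ, γ0, sub_zero] at h1
    have h2 : γ τ - x = (γ τ - q₂) + (q₂ - (x + v)) + v := by abel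
    rw [h2]
    have h3 : 21 / 10 * |τ| ≤ 21 / 10 * s := by gcongr
    refine (norm_add₃_le).trans ?_
    rw [hsv]
    linarith
  have hadm : IsAdmissible f T c (64 * D) y μ δ Δ z z'' := by
    refine ⟨hb1, ⟨l', hl0.trans hll', hl'μ, hb2⟩, ?_, by linarith, β / 2, half_pos hβ0,
      fun t ht => ?_⟩
    · have : γ τ - xn = (γ τ - x) + (x - xn) := by abel
      change ‖γ τ - xn‖ < δ
      rw [this]
      refine (norm_add_le _ _).trans_lt ?_
      linarith
    change |f (γ τ + t • en) - f (γ τ) - an * t| ≤ _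
    have hsq1 : √(z'.gauge c y - z.gauge c y) ≤ √(z''.gauge c y - z.gauge c y) :=
      Real.sqrt_le_sqrt (by linarith)
    have hsq2 : √h ≤ √(z''.gauge c y - z.gauge c y) := Real.sqrt_le_sqrt (by linarith)
    rcases le_or_gt (ρ / 2) |t| with htρ | htρ
    · have h1 := hslope t ht
      have h2 := hf.abs_sub_le_norm (γ τ + t • en) (x + t • en)
      have h3 := hf.abs_sub_le_norm (γ τ) x
      rw [add_sub_add_right_eq_sub] at h2
      have h4 : f (γ τ + t • en) - f (γ τ) - an * t = (f (γ τ + t • en) - f (x + t • en)) -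
        (f (γ τ) - f x) + (f (x + t • en) - f x - an * t) := by ring
      have h5 : 6 * s ≤ β / 2 * |t| := by
        have : β / 2 * (ρ / 2) ≤ β / 2 * |t| := by gcongr
        linarith
      have h6 : (64 * D - β₀ + 64 * √(z'.gauge c y - z.gauge c y)) * |t| ≤
          (64 * D - β + 64 * √(z''.gauge c y - z.gauge c y)) * |t| := by
        have : β ≤ β₀ := min_le_left _ _
        gcongr
      rw [h4]
      refine (abs_add_le _ _).trans ((add_le_add_left (abs_sub _ _) _).trans ?_)
      linarith
    · refine le_trans (b := (32 * D + 64 * √h) * |t|) ?_ (by gcongr; linarith)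
      have hcl1 : ‖e - en‖ * |t| + |a - an| * |t| ≤ 4 * D * |t| := by
        rw [← add_mul]; gcongr
      have hat : |(a - an) * t| = |a - an| * |t| := abs_mul _ _
      by_cases hin : τ + t ∈ Set.Icc (-s) s
      · have h1 := hτ (τ + t) hin
        have h2 := hQL τ (τ + t)
        have h3 := norm_bentPath_sub_sub_le q₂ hue hwe τ (τ + t)
        rw [add_sub_cancel_left] at h1 h2 h3
        have h4 := hf.abs_sub_le_norm (γ τ + t • en) (γ (τ + t))
        have h5 : ‖γ τ + t • en - γ (τ + t)‖ ≤ 11 / 10 * D * |t| + ‖e - en‖ * |t| := by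
          have : γ τ + t • en - γ (τ + t) =
            -(γ (τ + t) - γ τ - t • e) - t • (e - en) := by module
          rw [this]
          refine (norm_sub_le _ _).trans ?_
          rw [norm_neg, norm_smul, Real.norm_eq_abs, mul_comm |t|]
          gcongr
        have h6 : f (γ τ + t • en) - f (γ τ) - an * t = (f (γ τ + t • en) - f (γ (τ + t))) +
            (φ (τ + t) - φ τ) + (Q (τ + t) - Q τ) + (a - an) * t := by
          simp only [hφ]; ring
        rw [h6]
        refine (abs_add_le _ _).trans ((add_le_add_left (abs_add_three _ _ _) _).trans ?_)
        rw [hat]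
        have : 0 ≤ D * |t| := by positivity
        linarith
      · have hts : s - |τ| ≤ |t| := by
          by_contra! hlt
          refine hin ((abs_le (a := τ + t)).1 ?_)
          linarith [abs_add_le τ t]
        have hts' : D ^ 2 * s ≤ |t| := by linarith
        have hts3 : D ^ 3 * s ≤ D * |t| := by
          have : D ^ 3 * s = D * (D ^ 2 * s) := by ring
          rw [this]; gcongr
        have hγt : ‖γ τ - (x + τ • e)‖ ≤ D * |t| + 11 / 10 * D * |t| :=
          hb3.trans (add_le_add hts3 (by gcongr))
        have h1 := hf.abs_sub_le_norm (γ τ + t • en) (x + (τ + t) • e)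
        have h2 : ‖γ τ + t • en - (x + (τ + t) • e)‖ ≤
            D * |t| + 11 / 10 * D * |t| + ‖e - en‖ * |t| := by
          have : γ τ + t • en - (x + (τ + t) • e) = (γ τ - (x + τ • e)) - t • (e - en) := by
            module
          rw [this]
          refine (norm_sub_le _ _).trans (add_le_add hγt ?_)
          rw [norm_smul, Real.norm_eq_abs, mul_comm]
        have h3 := (hf.abs_sub_le_norm (γ τ) (x + τ • e)).trans hγt
        have htt : |τ + t| ≤ |τ| + |t| := abs_add_le _ _
        have h4 := hρd (τ + t) (by linarith)
        have h5 := hρd τ (by linarith)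
        have h6 : f (γ τ + t • en) - f (γ τ) - an * t =
            (f (γ τ + t • en) - f (x + (τ + t) • e)) - (f (γ τ) - f (x + τ • e)) +
            ((f (x + (τ + t) • e) - f x - a * (τ + t)) - (f (x + τ • e) - f x - a * τ)) +
            (a - an) * t := by ring
        have h7 : D ^ 3 * |τ + t| ≤ D * |t| + D * |t| := by
          have : D ^ 3 * |τ + t| ≤ D ^ 3 * (s + |t|) := by gcongr; linarith
          have : D ^ 3 * |t| ≤ D * |t| := by gcongr; linarith
          linarith
        have h8 : D ^ 3 * |τ| ≤ D * |t| := le_trans (by gcongr) hts3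
        rw [h6]
        refine (abs_add_three _ _ _).trans ((add_le_add_left (add_le_add (abs_sub _ _)
          (abs_sub _ _)) _).trans ?_)
        rw [hat]
        have : 0 ≤ 64 * √h * |t| := by positivity
        have : 0 ≤ D * |t| := by positivity
        linarith
  have := hmax z'' hadm
  linarith
end Pairs

section Iteration
variable {E : Type*} [NormedAddCommGroup E] [InnerProductSpace ℝ E]

open Filter Topology

theorem LipschitzWith.abs_le_norm_of_hasLineDerivAt {f : E → ℝ} (hf : LipschitzWith 1 f) {a : ℝ}
    {x e : E} (h : HasLineDerivAt ℝ f a x e) : |a| ≤ ‖e‖ := by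
  have h1 := norm_lineDeriv_le_of_lipschitz ℝ hf (x₀ := x) (v := e)
  rw [h.lineDeriv] at h1
  simpa using h1

theorem DirPair.gauge_add (c t : ℝ) (y e : E) (z : DirPair E) :
    z.gauge (c + t) (y + t • e) =
      z.gauge c y - t / 2 * ‖z.dir - e‖ ^ 2 + t / 2 * ‖e‖ ^ 2 := by
  simp only [DirPair.gauge, ← real_inner_self_eq_norm_sq, inner_add_left, inner_sub_left,
    inner_sub_right, real_inner_smul_left, real_inner_comm e z.dir]
  ring

theorem abs_tilt_sub_le {c : ℝ} (hc0 : 0 ≤ c) (hc : c ≤ 2) {y e : E} (hy : ‖y‖ ≤ 2)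
    (he : ‖e‖ ≤ 2) (e' : E) :
    |(c / 2 * ‖e'‖ ^ 2 - inner ℝ y e') - (c / 2 * ‖e‖ ^ 2 - inner ℝ y e)| ≤
      6 * ‖e' - e‖ + ‖e' - e‖ ^ 2 := by
  have hp : ‖c • e - y‖ ≤ 6 := by
    refine (norm_sub_le _ _).trans ?_
    rw [norm_smul, Real.norm_eq_abs, abs_of_nonneg hc0]
    nlinarith [norm_nonneg e]
  rw [sub_gauge_sub]
  refine (abs_add_le _ _).trans (add_le_add ?_ ?_)
  · exact (abs_real_inner_le_norm _ _).trans (by gcongr)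
  · have := sq_nonneg ‖e' - e‖
    rw [abs_of_nonneg (by positivity)]
    nlinarith

/-- A stage of the construction. -/
structure Stage (E : Type*) where
  pair : DirPair E
  tilt : E
  level : ℝ
  levelBound : ℝ
  radius : ℝ
  scale : ℝ

/-- The pairs competing at a stage of accuracy `q`. -/
def Stage.Competes (f : E → ℝ) (T : ℝ → Set E) (q : ℝ) (s : Stage E) (z : DirPair E) : Prop :=
  IsAdmissible f T (2 - q) (64 * q) s.tilt s.levelBound s.radius s.scale s.pair z

/-- The invariant of the construction at accuracy `q`. -/
structure Stage.IsGood (f : E → ℝ) (T : ℝ → Set E) (q : ℝ) (s : Stage E) : Prop where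
  hasLineDerivAt : HasLineDerivAt ℝ f s.pair.slope s.pair.pt s.pair.dir
  level_pos : 0 < s.level
  level_lt : s.level < s.levelBound
  levelBound_lt : s.levelBound < 1
  mem : s.pair.pt ∈ T s.level
  radius_pos : 0 < s.radius
  radius_le : s.radius ≤ q
  scale_pos : 0 < s.scale
  abs_slope_le : ∀ t, |t| ≤ s.scale →
    |f (s.pair.pt + t • s.pair.dir) - f s.pair.pt - s.pair.slope * t| ≤ 32 * q * |t|
  norm_tilt_le : ‖s.tilt‖ ≤ 2 * (1 - q)
  close : ∀ z, s.Competes f T q z →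
    ‖z.dir‖ ≤ 2 ∧ ‖z.dir - s.pair.dir‖ + |z.slope - s.pair.slope| ≤ 4 * q

/-- The relation between consecutive stages. -/
structure Stage.IsNext (f : E → ℝ) (T : ℝ → Set E) (q : ℝ) (s s' : Stage E) : Prop where
  levelBound_lt : s'.levelBound < s.levelBound
  norm_add_lt : ‖s'.pair.pt - s.pair.pt‖ + s'.radius < s.radius
  competes : s.Competes f T q s'.pair
  gauge_le : ∀ z, s.Competes f T q z →
    z.gauge (2 - q) s.tilt ≤ s'.pair.gauge (2 - q) s.tilt + q ^ 3 / 256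
  tilt_eq : s'.tilt = s.tilt + (q / 2) • s'.pair.dir
  abs_slope_le : ∃ β > 0, ∀ z, s'.Competes f T (q / 2) z → ∀ t, |t| ≤ s.scale →
    |f (z.pt + t • s.pair.dir) - f z.pt - s.pair.slope * t| ≤
      (64 * q - β + 64 * √(z.gauge (2 - q) s.tilt - s.pair.gauge (2 - q) s.tilt)) * |t|

variable {f : E → ℝ} {T : ℝ → Set E} {q : ℝ} {s s' : Stage E}

theorem Stage.IsGood.competes_self (h : s.IsGood f T q) (hq : 0 < q) :
    s.Competes f T q s.pair := by
  refine ⟨h.hasLineDerivAt, ⟨_, h.level_pos, h.level_lt, h.mem⟩, by simpa using h.radius_pos,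
    le_rfl, 32 * q, by positivity, fun t ht => (h.abs_slope_le t ht).trans (le_of_eq ?_)⟩
  rw [sub_self, Real.sqrt_zero]
  ring

theorem DirPair.gauge_next (q : ℝ) (y e : E) (z : DirPair E) :
    z.gauge (2 - q / 2) (y + (q / 2) • e) =
      z.gauge (2 - q) y - q / 4 * ‖z.dir - e‖ ^ 2 + q / 4 * ‖e‖ ^ 2 := by
  have := z.gauge_add (2 - q) (q / 2) y e
  rw [show 2 - q + q / 2 = 2 - q / 2 by ring, show q / 2 / 2 = q / 4 by ring] at this
  exact this

theorem gauge_le_of_competes_next (htilt : s'.tilt = s.tilt + (q / 2) • s'.pair.dir)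
    {z : DirPair E} (hz : s'.Competes f T (q / 2) z) :
    s'.pair.gauge (2 - q) s.tilt + q / 4 * ‖z.dir - s'.pair.dir‖ ^ 2 ≤ z.gauge (2 - q) s.tilt := by
  have h := hz.gauge_le
  rw [htilt, DirPair.gauge_next, DirPair.gauge_next, sub_self, norm_zero] at h
  linarith

theorem Stage.IsNext.competes_of_competes (h : s.IsNext f T q s') (hq : 0 < q) {z : DirPair E}
    (hz : s'.Competes f T (q / 2) z) : s.Competes f T q z := by
  obtain ⟨l, hl0, hl, hm⟩ := hz.mem
  obtain ⟨β, hβ, hβ'⟩ := h.abs_slope_le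
  refine ⟨hz.hasLineDerivAt, ⟨l, hl0, hl.trans h.levelBound_lt, hm⟩, ?_, ?_, β, hβ, hβ' z hz⟩
  · have h1 := norm_add_le (z.pt - s'.pair.pt) (s'.pair.pt - s.pair.pt)
    rw [sub_add_sub_cancel] at h1
    linarith [hz.near, h.norm_add_lt]
  · have h1 := gauge_le_of_competes_next h.tilt_eq hz
    have h2 := h.competes.gauge_le
    have : 0 ≤ q / 4 * ‖z.dir - s'.pair.dir‖ ^ 2 := by positivity
    linarith

theorem Stage.IsGood.exists_isNext (hf : LipschitzWith 1 f) (hq : 0 < q) (hq1 : q ≤ 1)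
    (h : s.IsGood f T q) : ∃ s' : Stage E, s'.IsGood f T (q / 2) ∧ s.IsNext f T q s' := by
  have hy : ‖s.tilt‖ ≤ 2 := h.norm_tilt_le.trans (by linarith)
  obtain ⟨z, hz, hzmax⟩ : ∃ z, s.Competes f T q z ∧ ∀ z', s.Competes f T q z' →
      z'.gauge (2 - q) s.tilt ≤ z.gauge (2 - q) s.tilt + q ^ 3 / 256 := by
    set V := {g | ∃ z, s.Competes f T q z ∧ z.gauge (2 - q) s.tilt = g} with hV
    have hne : V.Nonempty := ⟨_, s.pair, h.competes_self hq, rfl⟩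
    have hbdd : BddAbove V := by
      refine ⟨6, ?_⟩
      rintro _ ⟨z, hz, rfl⟩
      have h1 := (h.close z hz).1
      have h2 := (le_abs_self _).trans (hf.abs_le_norm_of_hasLineDerivAt hz.hasLineDerivAt)
      have h3 : inner ℝ s.tilt z.dir ≤ 2 * 2 := (real_inner_le_norm _ _).trans (by gcongr)
      have h4 : 0 ≤ (2 - q) / 2 * ‖z.dir‖ ^ 2 := mul_nonneg (by linarith) (sq_nonneg _)
      unfold DirPair.gauge
      linarith
    obtain ⟨_, ⟨z, hz, rfl⟩, hlt⟩ := exists_lt_of_lt_csSup hne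
      (show sSup V - q ^ 3 / 256 < sSup V by linarith [show 0 < q ^ 3 / 256 by positivity])
    refine ⟨z, hz, fun z' hz' => ?_⟩
    have := le_csSup hbdd ⟨z', hz', rfl⟩
    linarith
  obtain ⟨hder, ⟨l, hl0, hlμ, hlT⟩, hnear, hG, α, hα, hslope⟩ := id hz
  obtain ⟨he, hclose⟩ := h.close z hz
  obtain ⟨Δ', hΔ', hΔ⟩ := hder.exists_abs_sub_le (σ := 32 * (q / 2)) (by positivity)
  set δ' := min (min (q / 2) ((s.radius - ‖z.pt - s.pair.pt‖) / 2)) (α * Δ' / 4) with hδ'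
  have hδ0 : 0 < δ' := lt_min (lt_min (by positivity) (by linarith)) (by positivity)
  have hδq : δ' ≤ q / 2 := (min_le_left _ _).trans (min_le_left _ _)
  have hδr : δ' ≤ (s.radius - ‖z.pt - s.pair.pt‖) / 2 := (min_le_left _ _).trans (min_le_right _ _)
  have hδα : δ' ≤ α * Δ' / 4 := min_le_right _ _
  set s' : Stage E := ⟨z, s.tilt + (q / 2) • z.dir, l, (l + s.levelBound) / 2, δ', Δ'⟩ with hs'
  have hnext : s.IsNext f T q s' := by
    refine ⟨by simp only [hs']; linarith, by simp only [hs']; linarith, hz, hzmax, rfl,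
      min (α / 2) (28 * q), lt_min (by positivity) (by positivity), fun w hw t ht => ?_⟩
    have hg := gauge_le_of_competes_next rfl hw
    have hg0 : 0 ≤ q / 4 * ‖w.dir - z.dir‖ ^ 2 := by positivity
    simp only [hs'] at hg
    rcases le_or_gt |t| Δ' with htΔ | htΔ
    · obtain ⟨-, -, -, hwG, α', hα', hw'⟩ := hw
      replace hw' := hw' t htΔ
      simp only [hs'] at hwG hw'
      rw [DirPair.gauge_next, DirPair.gauge_next, sub_self, norm_zero] at hw'
      have hsq : √(w.gauge (2 - q) s.tilt - q / 4 * ‖w.dir - z.dir‖ ^ 2 + q / 4 * ‖z.dir‖ ^ 2 -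
          (z.gauge (2 - q) s.tilt - q / 4 * 0 ^ 2 + q / 4 * ‖z.dir‖ ^ 2)) ≤
          √(w.gauge (2 - q) s.tilt - s.pair.gauge (2 - q) s.tilt) :=
        Real.sqrt_le_sqrt (by linarith)
      have h1 := hf.abs_sub_le_norm (w.pt + t • s.pair.dir) (w.pt + t • z.dir)
      rw [add_sub_add_left_eq_sub, ← smul_sub, norm_smul, Real.norm_eq_abs, norm_sub_rev] at h1
      have h2 : |(z.slope - s.pair.slope) * t| = |z.slope - s.pair.slope| * |t| := abs_mul _ _
      have h3 : f (w.pt + t • s.pair.dir) - f w.pt - s.pair.slope * t =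
          (f (w.pt + t • s.pair.dir) - f (w.pt + t • z.dir)) +
          (f (w.pt + t • z.dir) - f w.pt - z.slope * t) + (z.slope - s.pair.slope) * t := by ring
      rw [h3]
      refine (abs_add_three _ _ _).trans ?_
      rw [h2]
      calc _ ≤ |t| * ‖z.dir - s.pair.dir‖ + (64 * (q / 2) - α' + 64 * √(w.gauge (2 - q) s.tilt -
            s.pair.gauge (2 - q) s.tilt)) * |t| + |z.slope - s.pair.slope| * |t| := by
            refine add_le_add (add_le_add h1 (hw'.trans ?_)) le_rfl
            gcongr
        _ = (‖z.dir - s.pair.dir‖ + |z.slope - s.pair.slope| + (64 * (q / 2) - α' + 64 *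
            √(w.gauge (2 - q) s.tilt - s.pair.gauge (2 - q) s.tilt))) * |t| := by ring
        _ ≤ _ := by
            have := min_le_right (α / 2) (28 * q)
            refine mul_le_mul_of_nonneg_right ?_ (abs_nonneg t)
            linarith
    · have hwn := hw.near
      simp only [hs'] at hwn
      have hsq : √(z.gauge (2 - q) s.tilt - s.pair.gauge (2 - q) s.tilt) ≤
          √(w.gauge (2 - q) s.tilt - s.pair.gauge (2 - q) s.tilt) :=
        Real.sqrt_le_sqrt (by linarith)
      have h1 := hf.abs_sub_le_norm (w.pt + t • s.pair.dir) (z.pt + t • s.pair.dir)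
      rw [add_sub_add_right_eq_sub] at h1
      have h2 := hf.abs_sub_le_norm w.pt z.pt
      have h3 : f (w.pt + t • s.pair.dir) - f w.pt - s.pair.slope * t =
          (f (w.pt + t • s.pair.dir) - f (z.pt + t • s.pair.dir)) - (f w.pt - f z.pt) +
          (f (z.pt + t • s.pair.dir) - f z.pt - s.pair.slope * t) := by ring
      have h4 : α / 2 * Δ' ≤ α / 2 * |t| := by gcongr
      rw [h3]
      refine (abs_add_le _ _).trans ((add_le_add_left (abs_sub _ _) _).trans ?_)
      calc _ ≤ (64 * q - α / 2 + 64 * √(z.gauge (2 - q) s.tilt -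
            s.pair.gauge (2 - q) s.tilt)) * |t| := by
            have := hslope t ht
            linarith
        _ ≤ _ := by
            have := min_le_left (α / 2) (28 * q)
            gcongr
  refine ⟨s', ⟨hder, hl0, by simp only [hs']; linarith, ?_, hlT, hδ0, hδq, hΔ', hΔ, ?_,
    fun w hw => ?_⟩, hnext⟩
  · simp only [hs']; linarith [h.levelBound_lt]
  · refine (norm_add_le _ _).trans ?_
    rw [norm_smul, Real.norm_eq_abs, abs_of_pos (by positivity)]
    nlinarith [h.norm_tilt_le]
  · have hw' := hnext.competes_of_competes hq hw
    have h1 := gauge_le_of_competes_next hnext.tilt_eq hw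
    have h2 := hzmax w hw'
    simp only [hs'] at h1 ⊢
    have h3 : ‖w.dir - z.dir‖ ≤ q / 8 := by
      refine abs_le_of_sq_le_sq' ?_ (by positivity) |>.2
      have : q / 4 * ‖w.dir - z.dir‖ ^ 2 ≤ q / 4 * (q / 8) ^ 2 := by linarith
      exact le_of_mul_le_mul_left this (by positivity)
    refine ⟨(h.close w hw').1, ?_⟩
    have h4 := abs_tilt_sub_le (c := 2 - q) (by linarith) (by linarith) hy he w.dir
    have h5 : ‖w.dir - z.dir‖ ^ 2 ≤ (q / 8) ^ 2 := by gcongr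
    have h6 : q ^ 3 ≤ q := by
      simpa using pow_le_pow_of_le_one hq.le hq1 (show 1 ≤ 3 by norm_num)
    have h7 : q ^ 2 ≤ q := by
      simpa using pow_le_pow_of_le_one hq.le hq1 (show 1 ≤ 2 by norm_num)
    have h8 : |w.slope - z.slope| ≤ q ^ 3 / 256 + (6 * (q / 8) + (q / 8) ^ 2) := by
      have e : w.slope - z.slope = (w.gauge (2 - q) s.tilt - z.gauge (2 - q) s.tilt) +
          (((2 - q) / 2 * ‖w.dir‖ ^ 2 - inner ℝ s.tilt w.dir) -
            ((2 - q) / 2 * ‖z.dir‖ ^ 2 - inner ℝ s.tilt z.dir)) := by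
        simp only [DirPair.gauge]; ring
      rw [e]
      refine (abs_add_le _ _).trans (add_le_add ?_ (by linarith))
      have : 0 ≤ q / 4 * ‖w.dir - z.dir‖ ^ 2 := by positivity
      rw [abs_of_nonneg (by linarith)]
      linarith
    linarith

/-- The first stage, at a prescribed point and with zero direction. -/
theorem Stage.exists_isGood_one (hf : LipschitzWith 1 f) {x : E} {l r : ℝ} (hl0 : 0 < l)
    (hl1 : l < 1) (hx : x ∈ T l) (hr : 0 < r) :
    ∃ s : Stage E, s.IsGood f T 1 ∧ s.pair.pt = x ∧ s.radius ≤ r := by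
  refine ⟨⟨⟨x, 0, 0⟩, 0, l, (l + 1) / 2, min 1 r, 1⟩, ⟨hasLineDerivAt_zero, hl0, ?_, ?_, hx,
    lt_min one_pos hr, min_le_left _ _, one_pos, fun t _ => ?_, by simp, fun z hz => ?_⟩, rfl,
    min_le_right _ _⟩
  · dsimp only; linarith
  · dsimp only; linarith
  · simp
  · have h1 := hf.abs_le_norm_of_hasLineDerivAt hz.hasLineDerivAt
    have h2 := hz.gauge_le
    simp only [DirPair.gauge, norm_zero, inner_zero_left] at h2
    have h3 := (abs_le.1 h1).2
    have h4 : ‖z.dir‖ ≤ 2 := by nlinarith [norm_nonneg z.dir]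
    refine ⟨h4, ?_⟩
    simp only [sub_zero]
    linarith

theorem exists_stage_sequence (hf : LipschitzWith 1 f) {x : E} {l r : ℝ} (hl0 : 0 < l)
    (hl1 : l < 1) (hx : x ∈ T l) (hr : 0 < r) :
    ∃ S : ℕ → Stage E, (∀ n, (S n).IsGood f T ((1 / 2) ^ n)) ∧
      (∀ n, (S n).IsNext f T ((1 / 2) ^ n) (S (n + 1))) ∧ (S 0).pair.pt = x ∧
      (S 0).radius ≤ r := by
  obtain ⟨s₀, hs₀, hs₁, hs₂⟩ := Stage.exists_isGood_one hf hl0 hl1 hx hr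
  have step : ∀ n (s : {s : Stage E // s.IsGood f T ((1 / 2) ^ n)}),
      ∃ s' : {s : Stage E // s.IsGood f T ((1 / 2) ^ (n + 1))},
        s.1.IsNext f T ((1 / 2) ^ n) s'.1 := fun n s => by
    obtain ⟨s', h1, h2⟩ := s.2.exists_isNext hf (by positivity)
      (pow_le_one₀ (by norm_num) (by norm_num))
    refine ⟨⟨s', ?_⟩, h2⟩
    rwa [pow_succ, mul_one_div]
  choose F hF using step
  let S : ∀ n, {s : Stage E // s.IsGood f T ((1 / 2) ^ n)} := fun n =>
    Nat.rec ⟨s₀, by simpa using hs₀⟩ (fun n s => F n s) n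
  exact ⟨fun n => (S n).1, fun n => (S n).2, fun n => hF n (S n), hs₁, hs₂⟩

/-- The limit of a sequence of stages competes at every stage. -/
theorem exists_limit_pair [CompleteSpace E] (hf : LipschitzWith 1 f)
    (hTc : ∀ l, 0 < l → l < 1 → IsClosed (T l))
    (hTm : ∀ l l', 0 < l → l ≤ l' → l' < 1 → T l ⊆ T l') {S : ℕ → Stage E}
    (hS : ∀ n, (S n).IsGood f T ((1 / 2) ^ n))
    (hN : ∀ n, (S n).IsNext f T ((1 / 2) ^ n) (S (n + 1))) :
    ∃ z : DirPair E, ‖z.dir‖ ≤ 2 ∧ ∀ n, (S n).Competes f T ((1 / 2) ^ n) z ∧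
      ‖z.dir - (S n).pair.dir‖ + |z.slope - (S n).pair.slope| ≤ 4 * (1 / 2) ^ n ∧
      ∀ w, (S n).Competes f T ((1 / 2) ^ n) w →
        w.gauge (2 - (1 / 2) ^ n) (S n).tilt ≤
          z.gauge (2 - (1 / 2) ^ n) (S n).tilt + ((1 / 2) ^ n) ^ 3 / 256 := by
  have hq0 : ∀ n, (0 : ℝ) < (1 / 2) ^ n := fun n => by positivity
  have hq1 : ∀ n, (1 / 2 : ℝ) ^ n ≤ 1 := fun n => pow_le_one₀ (by norm_num) (by norm_num)
  have hqs : ∀ n, (1 / 2 : ℝ) ^ (n + 1) = (1 / 2) ^ n / 2 := fun n => by rw [pow_succ]; ring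
  have hlim : Tendsto (fun n : ℕ => (1 / 2 : ℝ) ^ n) atTop (𝓝 0) :=
    tendsto_pow_atTop_nhds_zero_of_lt_one (by norm_num) (by norm_num)
  have hC : ∀ n m, n ≤ m → ∀ z, (S m).Competes f T ((1 / 2) ^ m) z →
      (S n).Competes f T ((1 / 2) ^ n) z := by
    intro n m hnm
    induction m, hnm using Nat.le_induction with
    | base => exact fun z hz => hz
    | succ m _ ih =>
      exact fun z hz => ih z ((hN m).competes_of_competes (hq0 m) (by rwa [← hqs]))
  have hCm : ∀ n m, n ≤ m → (S n).Competes f T ((1 / 2) ^ n) (S m).pair := fun n m h =>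
    hC n m h _ ((hS m).competes_self (hq0 m))
  have hclose : ∀ n m, n ≤ m → ‖(S m).pair.dir - (S n).pair.dir‖ +
      |(S m).pair.slope - (S n).pair.slope| ≤ 4 * (1 / 2) ^ n := fun n m h =>
    ((hS n).close _ (hCm n m h)).2
  have hlim4 : Tendsto (fun n : ℕ => 4 * (1 / 2 : ℝ) ^ n) atTop (𝓝 0) := by
    simpa using hlim.const_mul 4
  obtain ⟨x, hx⟩ := cauchySeq_tendsto_of_complete
    (u := fun n => (S n).pair.pt) (cauchySeq_of_le_tendsto_0' _ (fun n m h => by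
      rw [dist_eq_norm, norm_sub_rev]
      exact (hCm n m h).near.le.trans (hS n).radius_le) hlim)
  obtain ⟨e, he⟩ := cauchySeq_tendsto_of_complete
    (u := fun n => (S n).pair.dir) (cauchySeq_of_le_tendsto_0' _ (fun n m h => by
      rw [dist_eq_norm, norm_sub_rev]
      linarith [hclose n m h, abs_nonneg ((S m).pair.slope - (S n).pair.slope)]) hlim4)
  obtain ⟨a, ha⟩ := cauchySeq_tendsto_of_complete
    (u := fun n => (S n).pair.slope) (cauchySeq_of_le_tendsto_0' _ (fun n m h => by
      rw [dist_comm, Real.dist_eq]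
      linarith [hclose n m h, norm_nonneg ((S m).pair.dir - (S n).pair.dir)]) hlim4)
  have hed : ‖e‖ ≤ 2 := le_of_tendsto he.norm
    (Eventually.of_forall fun n => ((hS n).close _ (hCm n n le_rfl)).1)
  have hcl : ∀ n, ‖e - (S n).pair.dir‖ + |a - (S n).pair.slope| ≤ 4 * (1 / 2) ^ n := fun n =>
    le_of_tendsto ((he.sub_const _).norm.add (ha.sub_const _).abs)
      (eventually_atTop.2 ⟨n, fun m hm => hclose n m hm⟩)
  set z : DirPair E := ⟨x, e, a⟩ with hz
  have hgauge : ∀ n, Tendsto (fun m => (S m).pair.gauge (2 - (1 / 2) ^ n) (S n).tilt) atTop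
      (𝓝 (z.gauge (2 - (1 / 2) ^ n) (S n).tilt)) := fun n =>
    (ha.sub ((he.norm.pow 2).const_mul _)).add (tendsto_const_nhds.inner he)
  have hg1 : ∀ n, (S (n + 1)).pair.gauge (2 - (1 / 2) ^ n) (S n).tilt ≤
      z.gauge (2 - (1 / 2) ^ n) (S n).tilt := fun n => by
    refine ge_of_tendsto (hgauge n) (eventually_atTop.2 ⟨n + 1, fun m hm => ?_⟩)
    have h1 := hCm (n + 1) m hm
    rw [hqs] at h1
    have h2 := gauge_le_of_competes_next (hN n).tilt_eq h1
    have h3 := hq0 n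
    have : 0 ≤ (1 / 2 : ℝ) ^ n / 4 * ‖(S m).pair.dir - (S (n + 1)).pair.dir‖ ^ 2 := by positivity
    linarith
  have hslope : ∀ n, ∃ β > 0, ∀ t, |t| ≤ (S n).scale →
      |f (x + t • (S n).pair.dir) - f x - (S n).pair.slope * t| ≤
        (64 * (1 / 2) ^ n - β + 64 * √(z.gauge (2 - (1 / 2) ^ n) (S n).tilt -
          (S n).pair.gauge (2 - (1 / 2) ^ n) (S n).tilt)) * |t| := by
    intro n
    obtain ⟨β, hβ, hβ'⟩ := (hN n).abs_slope_le
    refine ⟨β, hβ, fun t ht => ?_⟩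
    have hc := hf.continuous
    refine le_of_tendsto_of_tendsto (b := atTop)
      (f := fun m => |f ((S m).pair.pt + t • (S n).pair.dir) - f (S m).pair.pt -
        (S n).pair.slope * t|)
      (g := fun m => (64 * (1 / 2) ^ n - β + 64 * √((S m).pair.gauge (2 - (1 / 2) ^ n) (S n).tilt -
          (S n).pair.gauge (2 - (1 / 2) ^ n) (S n).tilt)) * |t|) ?_ ?_
      (eventually_atTop.2 ⟨n + 1, fun m hm => hβ' _ (hqs n ▸ hCm (n + 1) m hm) t ht⟩)
    · exact ((((hc.tendsto _).comp (hx.add_const _)).sub ((hc.tendsto _).comp hx)).sub_const _).abs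
    · exact (((((hgauge n).sub_const _).sqrt).const_mul _).const_add _).mul_const _
  have hder : HasLineDerivAt ℝ f a x e := by
    have hb : Tendsto (fun n : ℕ => 68 * (1 / 2 : ℝ) ^ n + 64 * √(44 * (1 / 2) ^ n)) atTop
        (𝓝 0) := by
      have := (hlim.const_mul 68).add (((hlim.const_mul 44).sqrt).const_mul 64)
      simpa using this
    refine hasDerivAt_iff_isLittleO.2 (Asymptotics.isLittleO_iff.2 fun σ hσ => ?_)
    obtain ⟨n, hn⟩ := (hb.eventually_lt_const hσ).exists
    obtain ⟨β, hβ, hβ'⟩ := hslope n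
    refine Metric.eventually_nhds_iff.2 ⟨(S n).scale, (hS n).scale_pos, fun t ht => ?_⟩
    rw [Real.dist_eq, sub_zero] at ht
    have h1 := hβ' t ht.le
    have hcn := hcl n
    have hsq : √(z.gauge (2 - (1 / 2) ^ n) (S n).tilt -
          (S n).pair.gauge (2 - (1 / 2) ^ n) (S n).tilt) ≤ √(44 * (1 / 2) ^ n) := by
      refine Real.sqrt_le_sqrt ?_
      have h2 : ‖(S n).pair.dir‖ ≤ 2 := ((hS n).close _ (hCm n n le_rfl)).1
      have hy : ‖(S n).tilt‖ ≤ 2 := (hS n).norm_tilt_le.trans (by linarith [hq0 n])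
      have h3 := abs_le.1 (abs_tilt_sub_le (c := 2 - (1 / 2) ^ n) (by linarith [hq1 n])
        (by linarith [hq0 n]) hy h2 e)
      have h4 := le_abs_self (a - (S n).pair.slope)
      have h5 : ‖e - (S n).pair.dir‖ ^ 2 ≤ 4 * (4 * (1 / 2) ^ n) := by
        rw [sq]
        gcongr
        · linarith [hq1 n, abs_nonneg (a - (S n).pair.slope)]
        · linarith [abs_nonneg (a - (S n).pair.slope)]
      have h6 := abs_nonneg (a - (S n).pair.slope)
      simp only [DirPair.gauge, hz]
      linarith [norm_nonneg (e - (S n).pair.dir)]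
    have h2 := hf.abs_sub_le_norm (x + t • e) (x + t • (S n).pair.dir)
    rw [add_sub_add_left_eq_sub, ← smul_sub, norm_smul, Real.norm_eq_abs] at h2
    have h3 : |(a - (S n).pair.slope) * t| = |a - (S n).pair.slope| * |t| := abs_mul _ _
    have h4 : f (x + t • e) - f x - t * a =
        (f (x + t • e) - f (x + t • (S n).pair.dir)) +
        (f (x + t • (S n).pair.dir) - f x - (S n).pair.slope * t) -
        (a - (S n).pair.slope) * t := by ring
    simp only [zero_smul, add_zero, sub_zero, smul_eq_mul, Real.norm_eq_abs]
    rw [h4]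
    refine (abs_sub _ _).trans ((add_le_add_left (abs_add_le _ _) _).trans ?_)
    rw [h3]
    calc _ ≤ (‖e - (S n).pair.dir‖ + |a - (S n).pair.slope| + (64 * (1 / 2) ^ n - β + 64 *
          √(z.gauge (2 - (1 / 2) ^ n) (S n).tilt -
          (S n).pair.gauge (2 - (1 / 2) ^ n) (S n).tilt))) * |t| := by linarith
      _ ≤ σ * |t| := by
          refine mul_le_mul_of_nonneg_right ?_ (abs_nonneg t)
          linarith
  have hμanti : StrictAnti fun n => (S n).levelBound :=
    strictAnti_nat_of_succ_lt fun n => (hN n).levelBound_lt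
  have hmem : ∀ n, x ∈ T (S n).levelBound := fun n => by
    have hn := hS n
    refine (hTc _ (hn.level_pos.trans hn.level_lt) hn.levelBound_lt).mem_of_tendsto hx
      (eventually_atTop.2 ⟨n, fun m hm => ?_⟩)
    exact hTm _ _ (hS m).level_pos ((hS m).level_lt.le.trans (hμanti.antitone hm))
      hn.levelBound_lt (hS m).mem
  refine ⟨z, hed, fun n => ⟨⟨hder, ⟨(S (n + 1)).levelBound, ?_, hμanti n.lt_succ_self,
    hmem (n + 1)⟩, ?_, (hN n).competes.gauge_le.trans (hg1 n), hslope n⟩, hcl n,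
    fun w hw => ((hN n).gauge_le w hw).trans (by linarith [hg1 n])⟩⟩
  · exact (hS (n + 1)).level_pos.trans (hS (n + 1)).level_lt
  · have h1 : ‖x - (S (n + 1)).pair.pt‖ ≤ (S (n + 1)).radius :=
      le_of_tendsto (hx.sub_const _).norm
        (eventually_atTop.2 ⟨n + 1, fun m hm => (hCm (n + 1) m hm).near.le⟩)
    have h2 := norm_add_le (x - (S (n + 1)).pair.pt) ((S (n + 1)).pair.pt - (S n).pair.pt)
    rw [sub_add_sub_cancel] at h2
    linarith [(hN n).norm_add_lt]

theorem HasBrokenLines.exists_differentiableAt_near [CompleteSpace E] (hT : HasBrokenLines T)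
    (hTc : ∀ l, 0 < l → l < 1 → IsClosed (T l))
    (hTm : ∀ l l', 0 < l → l ≤ l' → l' < 1 → T l ⊆ T l') (hf : LipschitzWith 1 f)
    {x : E} {l r : ℝ} (hl0 : 0 < l) (hl1 : l < 1) (hx : x ∈ T l) (hr : 0 < r) :
    ∃ x' l', 0 < l' ∧ l' < 1 ∧ x' ∈ T l' ∧ ‖x' - x‖ < r ∧ DifferentiableAt ℝ f x' := by
  obtain ⟨S, hS, hN, hS0, hSr⟩ := exists_stage_sequence hf hl0 hl1 hx hr
  obtain ⟨z, hze, hz⟩ := exists_limit_pair hf hTc hTm hS hN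
  have hq0 : ∀ n, (0 : ℝ) < (1 / 2) ^ n := fun n => by positivity
  have hq1 : ∀ n, (1 / 2 : ℝ) ^ n ≤ 1 := fun n => pow_le_one₀ (by norm_num) (by norm_num)
  have hlim : Tendsto (fun n : ℕ => (1 / 2 : ℝ) ^ n) atTop (𝓝 0) :=
    tendsto_pow_atTop_nhds_zero_of_lt_one (by norm_num) (by norm_num)
  obtain ⟨l', hl'0, hl', hzl'⟩ := (hz 0).1.mem
  refine ⟨z.pt, l', hl'0, hl'.trans (hS 0).levelBound_lt, hzl', ?_, ?_⟩
  · rw [← hS0]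
    exact (hz 0).1.near.trans_le hSr
  obtain ⟨y, hy⟩ := cauchySeq_tendsto_of_complete (u := fun n => (S n).tilt)
    (cauchySeq_of_le_geometric (1 / 2) 1 (by norm_num) fun n => by
      have h1 : ‖(S (n + 1)).pair.dir‖ ≤ 2 := ((hS n).close _ (hN n).competes).1
      rw [dist_comm, dist_eq_norm, (hN n).tilt_eq, add_sub_cancel_left, norm_smul, Real.norm_eq_abs,
        abs_of_pos (half_pos (hq0 n))]
      nlinarith [hq0 n])
  have hp : Tendsto (fun n => (2 - (1 / 2 : ℝ) ^ n) • z.dir - (S n).tilt) atTop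
      (𝓝 ((2 - (0 : ℝ)) • z.dir - y)) := ((hlim.const_sub 2).smul_const _).sub hy
  set p := (2 - (0 : ℝ)) • z.dir - y
  refine HasFDerivAt.differentiableAt (f' := innerSL ℝ p)
    (hasFDerivAt_iff_isLittleO_nhds_zero.2 (Asymptotics.isLittleO_iff.2 fun ε hε => ?_))
  obtain ⟨n, hn1, hn2, hn3⟩ := ((hlim.eventually_lt_const
    (show 0 < min (1 / 100) (ε / 112) by positivity)).and
    ((Metric.tendsto_nhds.1 hp (ε / 2) (half_pos hε)).and
      (Eventually.of_forall fun n => hq0 n))).exists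
  set q : ℝ := (1 / 2) ^ n with hq
  have hq100 : q < 1 / 100 := hn1.trans_le (min_le_left _ _)
  have hqε : q < ε / 112 := hn1.trans_le (min_le_right _ _)
  obtain ⟨hadm, hcl, hmax⟩ := hz n
  have hsl : |z.slope| ≤ 2 :=
    (hf.abs_le_norm_of_hasLineDerivAt hadm.hasLineDerivAt).trans hze
  obtain ⟨ρ, hρ, hρ'⟩ := hadm.exists_forall_abs_sub_inner_le hf hT (D := q) (ε := ε / 2)
    (κ := q ^ 3 / 256) (hS n).levelBound_lt (by linarith) (by linarith)
    ((hS n).norm_tilt_le.trans (by linarith)) hze hsl hmax hcl hn3 hq100.le (by linarith) (by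
      have h1 : q ^ 2 ≤ q / 100 := by nlinarith
      have h2 : q ^ 3 = q * q ^ 2 := by ring
      have h3 : q * q ^ 2 ≤ q * (ε / 112 / 100) := by gcongr; linarith
      have h4 : 0 < q * ε := by positivity
      linarith)
  refine Metric.eventually_nhds_iff.2 ⟨ρ, hρ, fun v hv => ?_⟩
  rw [dist_zero_right] at hv
  have h1 := hρ' v hv
  rw [dist_eq_norm] at hn2
  have h2 := (abs_real_inner_le_norm ((2 - q) • z.dir - (S n).tilt - p) v).trans
    (mul_le_mul_of_nonneg_right hn2.le (norm_nonneg v))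
  rw [inner_sub_left] at h2
  have h3 : f (z.pt + v) - f z.pt - inner ℝ p v =
      (f (z.pt + v) - f z.pt - inner ℝ ((2 - q) • z.dir - (S n).tilt) v) +
      (inner ℝ ((2 - q) • z.dir - (S n).tilt) v - inner ℝ p v) := by ring
  rw [innerSL_apply_apply, Real.norm_eq_abs, h3]
  refine (abs_add_le _ _).trans ?_
  linarith
end Iteration

section Window
variable {α : Type*} [PseudoMetricSpace α]

/-- Points lying, for every `k`, within `l * w n` of the set `R n` for some
`n` in the window `[k, (1 + l) * k]`. -/
def windowSet (R : ℕ → Set α) (w : ℕ → ℝ) (l : ℝ) : Set α :=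
  ⋂ k : ℕ, ⋃ n ∈ {n : ℕ | k ≤ n ∧ (n : ℝ) ≤ (1 + l) * k}, cthickening (l * w n) (R n)

theorem mem_windowSet {R : ℕ → Set α} {w : ℕ → ℝ} {l : ℝ} {x : α} : x ∈ windowSet R w l ↔
    ∀ k : ℕ, ∃ n : ℕ, k ≤ n ∧ (n : ℝ) ≤ (1 + l) * k ∧ x ∈ cthickening (l * w n) (R n) := by
  simp [windowSet, and_assoc]

theorem isClosed_windowSet (R : ℕ → Set α) (w : ℕ → ℝ) (l : ℝ) : IsClosed (windowSet R w l) := by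
  refine isClosed_iInter fun k ↦ Set.Finite.isClosed_biUnion ?_ fun n _ ↦ isClosed_cthickening
  exact (finite_Iic ⌊(1 + l) * k⌋₊).subset fun n hn ↦ Nat.le_floor hn.2

theorem windowSet_mono {R : ℕ → Set α} {w : ℕ → ℝ} (hw : ∀ n, 0 < w n) {l l' : ℝ}
    (h : l ≤ l') : windowSet R w l ⊆ windowSet R w l' := by
  intro x hx
  rw [mem_windowSet] at hx ⊢
  intro k
  obtain ⟨n, h1, h2, h3⟩ := hx k
  refine ⟨n, h1, h2.trans (by gcongr), cthickening_mono ?_ _ h3⟩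
  have := hw n
  gcongr

theorem isBounded_windowSet {R : ℕ → Set α} (hR : Bornology.IsBounded (R 0)) (w : ℕ → ℝ) (l : ℝ) :
    Bornology.IsBounded (windowSet R w l) := by
  refine (hR.cthickening (δ := l * w 0)).subset fun x hx ↦ ?_
  obtain ⟨n, h1, h2, h3⟩ := mem_windowSet.1 hx 0
  obtain rfl : n = 0 := by exact_mod_cast (by simpa using h2 : (n : ℝ) = 0)
  exact h3

theorem subset_windowSet {R : ℕ → Set α} {A : Set α} (hA : ∀ n, A ⊆ R n) (w : ℕ → ℝ) {l : ℝ}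
    (hl : 0 ≤ l) : A ⊆ windowSet R w l := fun x hx ↦ mem_windowSet.2 fun k ↦
  ⟨k, le_rfl, by nlinarith [(Nat.cast_nonneg k : (0 : ℝ) ≤ k)],
    self_subset_cthickening _ (hA k hx)⟩

end Window

section Nets
variable {E : Type*} [NormedAddCommGroup E] [NormedSpace ℝ E]

open Filter Topology

/-- The union of all segments with endpoints in `F`. -/
def segmentNet (F : Finset E) : Set E := ⋃ p ∈ F, ⋃ q ∈ F, segment ℝ p q

theorem segment_subset_segmentNet {F : Finset E} {p q : E} (hp : p ∈ F) (hq : q ∈ F) :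
    segment ℝ p q ⊆ segmentNet F := fun _ hx ↦ mem_iUnion₂.2 ⟨p, hp, mem_iUnion₂.2 ⟨q, hq, hx⟩⟩

theorem isBounded_segmentNet (F : Finset E) : Bornology.IsBounded (segmentNet F) := by
  refine (isBounded_convexHull.2 F.finite_toSet.isBounded).subset ?_
  refine iUnion₂_subset fun p hp ↦ iUnion₂_subset fun q hq ↦ ?_
  exact segment_subset_convexHull hp hq

theorem exists_cover_segmentNet (F : Finset E) {s : ℝ} (hs : 1 < s) {ε b : ℝ} (hε : 0 < ε)
    (hb : 0 < b) : ∃ w, 0 < w ∧ w ≤ b ∧ ∃ C : Finset E,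
      segmentNet F ⊆ ⋃ c ∈ C, closedBall c w ∧ (C.card : ℝ) * (4 * w) ^ s ≤ ε := by
  classical
  obtain ⟨L, hL, hLd⟩ : ∃ L : ℝ, 0 < L ∧ ∀ p ∈ F, ∀ q ∈ F, ‖q - p‖ ≤ L := by
    obtain ⟨M, hM⟩ := Metric.isBounded_iff.1 F.finite_toSet.isBounded
    refine ⟨max M 1, by positivity, fun p hp q hq ↦ ?_⟩
    rw [← dist_eq_norm]
    exact (hM hq hp).trans (le_max_left _ _)
  set A : ℝ := (F.card : ℝ) * F.card * 2 * (4 * L) ^ s with hA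
  have ht1 : Tendsto (fun N : ℕ ↦ A * (N : ℝ) ^ (-(s - 1))) atTop (𝓝 (A * 0)) :=
    ((tendsto_rpow_neg_atTop (by linarith)).comp tendsto_natCast_atTop_atTop).const_mul A
  have ht2 : Tendsto (fun N : ℕ ↦ L / (N : ℝ)) atTop (𝓝 0) :=
    tendsto_const_div_atTop_nhds_zero_nat L
  rw [mul_zero] at ht1
  obtain ⟨N, hN1, hN2, hN0⟩ := ((ht1.eventually_le_const hε).and
    ((ht2.eventually_le_const hb).and (eventually_gt_atTop 0))).exists
  have hN : (0 : ℝ) < N := by exact_mod_cast hN0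
  refine ⟨L / N, by positivity, hN2, ((F ×ˢ F) ×ˢ Finset.range (N + 1)).image
    (fun a ↦ a.1.1 + ((a.2 : ℝ) / N) • (a.1.2 - a.1.1)), ?_, ?_⟩
  · refine iUnion₂_subset fun p hp ↦ iUnion₂_subset fun q hq ↦ ?_
    rw [segment_eq_image']
    rintro _ ⟨t, ⟨ht0, ht1⟩, rfl⟩
    have hf1 : (⌊t * N⌋₊ : ℝ) ≤ t * N := Nat.floor_le (by positivity)
    have hf2 : t * N < ⌊t * N⌋₊ + 1 := Nat.lt_floor_add_one _
    refine mem_iUnion₂.2 ⟨p + ((⌊t * N⌋₊ : ℝ) / N) • (q - p),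
      Finset.mem_image.2 ⟨((p, q), ⌊t * N⌋₊), ?_, rfl⟩, ?_⟩
    · simp only [Finset.mem_product, Finset.mem_range]
      refine ⟨⟨hp, hq⟩, ?_⟩
      have : (⌊t * N⌋₊ : ℝ) < N + 1 := by nlinarith
      exact_mod_cast this
    · rw [mem_closedBall, dist_eq_norm, add_sub_add_left_eq_sub, ← sub_smul, norm_smul,
        Real.norm_eq_abs, div_eq_inv_mul L]
      refine mul_le_mul ?_ (hLd p hp q hq) (norm_nonneg _) (by positivity)
      have : t - ⌊t * N⌋₊ / N = (t * N - ⌊t * N⌋₊) * (N : ℝ)⁻¹ := by field_simp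
      rw [this, abs_of_nonneg (mul_nonneg (by linarith) (by positivity))]
      exact mul_le_of_le_one_left (by positivity) (by linarith)
  · refine le_trans ?_ hN1
    have hc : ((((F ×ˢ F) ×ˢ Finset.range (N + 1)).image
        (fun a : (E × E) × ℕ ↦ a.1.1 + ((a.2 : ℝ) / N) • (a.1.2 - a.1.1))).card : ℝ) ≤
        F.card * F.card * (2 * N) := by
      have h1 := Finset.card_image_le (s := (F ×ˢ F) ×ˢ Finset.range (N + 1))
        (f := fun a : (E × E) × ℕ ↦ a.1.1 + ((a.2 : ℝ) / N) • (a.1.2 - a.1.1))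
      rw [Finset.card_product, Finset.card_product, Finset.card_range] at h1
      have h2 : F.card * F.card * (N + 1) ≤ F.card * F.card * (2 * N) := by
        gcongr; omega
      exact_mod_cast h1.trans h2
    have e : (4 * (L / N)) ^ s = (4 * L) ^ s * (N : ℝ) ^ (-s) := by
      rw [← mul_div_assoc, Real.div_rpow (by positivity) hN.le, Real.rpow_neg hN.le]; rfl
    have e2 : (N : ℝ) ^ (-(s - 1)) = N * (N : ℝ) ^ (-s) := by
      rw [show -(s - 1) = 1 + -s by ring, Real.rpow_add hN, Real.rpow_one]
    calc _ ≤ F.card * F.card * (2 * N) * (4 * (L / N)) ^ s := by gcongr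
      _ = _ := by rw [e, e2, hA]; ring

/-- Increasing finite sets `F n`, decreasing scales `w n` and centres `C n` such that `F (n + 1)` is
dense at scale `w n`, while `segmentNet (F n)` has economical covers by balls of radius `w n`. -/
structure IsNetSequence (F : ℕ → Finset E) (w : ℕ → ℝ) (C : ℕ → Finset E) : Prop where
  mono : Monotone F
  pos : ∀ n, 0 < w n
  anti : Antitone w
  le_pow : ∀ n, w n ≤ (1 / 2) ^ n
  exists_near : ∀ (n : ℕ) (p : E), ‖p‖ ≤ n + 1 → ∃ q ∈ F (n + 1), ‖q - p‖ ≤ w n / (n + 1)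
  subset_cover : ∀ n, segmentNet (F n) ⊆ ⋃ c ∈ C n, closedBall c (w n)
  card_mul_le : ∀ n, ((C n).card : ℝ) * (4 * w n) ^ (1 + 1 / ((n : ℝ) + 1)) ≤ (1 / 2) ^ n

theorem exists_isNetSequence [ProperSpace E] (F₀ : Finset E) :
    ∃ F w C, F 0 = F₀ ∧ IsNetSequence (E := E) F w C := by
  classical
  have h1 (n : ℕ) (F : Finset E) (b : {b : ℝ // 0 < b}) : ∃ w : {b : ℝ // 0 < b}, w.1 ≤ b.1 ∧
      w.1 ≤ (1 / 2) ^ n ∧ ∃ C : Finset E, segmentNet F ⊆ ⋃ c ∈ C, closedBall c w.1 ∧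
        (C.card : ℝ) * (4 * w.1) ^ (1 + 1 / ((n : ℝ) + 1)) ≤ (1 / 2) ^ n := by
    have hs : (1 : ℝ) < 1 + 1 / ((n : ℝ) + 1) := by
      have : (0 : ℝ) < 1 / ((n : ℝ) + 1) := by positivity
      linarith
    obtain ⟨w, hw, hwb, C, hC⟩ := exists_cover_segmentNet F hs
      (ε := (1 / 2) ^ n) (b := min b.1 ((1 / 2) ^ n)) (by positivity) (lt_min b.2 (by positivity))
    exact ⟨⟨w, hw⟩, hwb.trans (min_le_left _ _), hwb.trans (min_le_right _ _), C, hC⟩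
  choose W hWb hWp C hC hCc using h1
  have h2 (n : ℕ) (F : Finset E) (b : {b : ℝ // 0 < b}) : ∃ F' : Finset E, F ⊆ F' ∧
      ∀ p : E, ‖p‖ ≤ n + 1 → ∃ q ∈ F', ‖q - p‖ ≤ b.1 / (n + 1) := by
    have hb : 0 < b.1 / ((n : ℝ) + 1) := div_pos b.2 (by positivity)
    obtain ⟨t, -, htf, ht⟩ := finite_cover_balls_of_compact
      (isCompact_closedBall (0 : E) ((n : ℝ) + 1)) hb
    refine ⟨F ∪ htf.toFinset, Finset.subset_union_left, fun p hp ↦ ?_⟩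
    obtain ⟨q, hq, hpq⟩ := mem_iUnion₂.1 (ht (by simpa using hp : p ∈ closedBall 0 ((n : ℝ) + 1)))
    refine ⟨q, Finset.mem_union_right _ (htf.mem_toFinset.2 hq), ?_⟩
    rw [← dist_eq_norm, dist_comm]
    exact (mem_ball.1 hpq).le
  choose G hFG hG using h2
  let S : ℕ → Finset E × {b : ℝ // 0 < b} := fun n ↦ Nat.rec (F₀, W 0 F₀ ⟨1, one_pos⟩)
    (fun n S ↦ (G n S.1 S.2, W (n + 1) (G n S.1 S.2) S.2)) n
  let b : ℕ → {b : ℝ // 0 < b} := fun n ↦ Nat.casesOn n ⟨1, one_pos⟩ fun n ↦ (S n).2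
  have hS (n : ℕ) : (S n).2 = W n (S n).1 (b n) := by cases n <;> rfl
  refine ⟨fun n ↦ (S n).1, fun n ↦ (S n).2.1, fun n ↦ C n (S n).1 (b n), rfl,
    monotone_nat_of_le_succ fun n ↦ hFG n _ _, fun n ↦ (S n).2.2,
    antitone_nat_of_succ_le fun n ↦ hWb (n + 1) _ _, fun n ↦ ?_, fun n ↦ hG n _ _,
    fun n ↦ ?_, fun n ↦ ?_⟩
  · rw [hS]; exact hWp _ _ _
  · rw [hS]; exact hC _ _ _
  · rw [hS]; exact hCc _ _ _

variable {F : ℕ → Finset E} {w : ℕ → ℝ} {C : ℕ → Finset E}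

theorem IsNetSequence.mem_windowSet_of_near (h : IsNetSequence F w C) {l l' s : ℝ} (hl : 0 < l)
    (hs : 0 ≤ s) {m : ℕ} (hm : ∀ n < m, s ≤ (l' - l) * w n) (hm' : 2 ≤ (l' - l) * m)
    (hl' : l' ≤ 1) {x y : E} (hx : x ∈ windowSet (fun n ↦ segmentNet (F n)) w l)
    (hxy : dist y x ≤ s) (hy : ∀ n, m < n → y ∈ segmentNet (F n)) :
    y ∈ windowSet (fun n ↦ segmentNet (F n)) w l' := by
  have hll : l < l' := by
    by_contra! hc
    nlinarith [(Nat.cast_nonneg m : (0 : ℝ) ≤ m)]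
  rw [mem_windowSet]
  intro k
  have hk0 : (0 : ℝ) ≤ k := Nat.cast_nonneg k
  by_cases hk : m < k
  · exact ⟨k, le_rfl, by nlinarith, self_subset_cthickening _ (hy k hk)⟩
  push Not at hk
  by_cases hk' : (m : ℝ) + 1 ≤ (1 + l') * k
  · exact ⟨m + 1, by omega, by exact_mod_cast hk', self_subset_cthickening _ (hy _ (by omega))⟩
  push Not at hk'
  obtain ⟨n, hn1, hn2, hn3⟩ := mem_windowSet.1 hx k
  have hnm : n < m := by
    by_contra! hc
    have hc' : (m : ℝ) ≤ n := by exact_mod_cast hc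
    have : (l' - l) * k < 1 := by nlinarith
    have h2 : (m : ℝ) ≤ 2 * k := by nlinarith
    nlinarith
  refine ⟨n, hn1, hn2.trans (by gcongr), ?_⟩
  have hw := h.pos n
  refine cthickening_mono (?_ : s + l * w n ≤ l' * w n) _
    (cthickening_cthickening_subset hs (by positivity) _
      (mem_cthickening_of_dist_le y x _ _ hn3 hxy))
  linarith [hm n hnm]

theorem IsNetSequence.tendsto_zero (h : IsNetSequence F w C) : Tendsto w atTop (𝓝 0) :=
  squeeze_zero (fun n ↦ (h.pos n).le) h.le_pow
    (tendsto_pow_atTop_nhds_zero_of_lt_one (by norm_num) (by norm_num))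

theorem IsNetSequence.dimH_windowSet_le [MeasurableSpace E] [BorelSpace E]
    (h : IsNetSequence F w C) :
    dimH (windowSet (fun n ↦ segmentNet (F n)) w 1) ≤ 1 := by
  refine dimH_le (d := 1) fun d' hd' ↦ ?_
  by_contra! hlt
  replace hlt : (1 : ℝ) < d' := by exact_mod_cast hlt
  let ι : ℕ → Type _ := fun k ↦ Σ n : {n // n ∈ Finset.Icc k (2 * k)}, {c // c ∈ C n.1}
  let t (k : ℕ) (i : ι k) : Set E := closedBall i.2.1 (2 * w i.1.1)
  have hdiam (n : ℕ) (c : E) : ediam (closedBall c (2 * w n)) ≤ ENNReal.ofReal (4 * w n) := by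
    have := h.pos n
    refine ediam_le_of_forall_dist_le fun x hx y hy ↦ ?_
    have := dist_triangle_right x y c
    rw [mem_closedBall] at hx hy
    linarith
  have hr : Tendsto (fun k ↦ ENNReal.ofReal (4 * w k)) atTop (𝓝 0) := by
    rw [← ENNReal.ofReal_zero]
    refine (ENNReal.continuous_ofReal.tendsto 0).comp ?_
    simpa using h.tendsto_zero.const_mul 4
  have key := Measure.hausdorffMeasure_le_liminf_sum (ι := ι) (d' : ℝ)
    (windowSet (fun n ↦ segmentNet (F n)) w 1) (l := atTop) (fun k ↦ ENNReal.ofReal (4 * w k)) hr t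
    (Eventually.of_forall fun k i ↦ (hdiam _ _).trans ?_) (Eventually.of_forall fun k x hx ↦ ?_)
  · have hlim : Tendsto (fun k ↦ ∑ i, ediam (t k i) ^ (d' : ℝ)) atTop (𝓝 0) := by
      have hg : Tendsto (fun k : ℕ ↦ ENNReal.ofReal (((k : ℝ) + 1) * (1 / 2) ^ k)) atTop (𝓝 0) := by
        rw [← ENNReal.ofReal_zero]
        refine (ENNReal.continuous_ofReal.tendsto 0).comp ?_
        have h1 := tendsto_self_mul_const_pow_of_lt_one (r := (1 / 2 : ℝ)) (by norm_num)
          (by norm_num)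
        have h2 := tendsto_pow_atTop_nhds_zero_of_lt_one (r := (1 / 2 : ℝ)) (by norm_num)
          (by norm_num)
        simpa [add_mul] using h1.add h2
      have hw4 : ∀ᶠ k in atTop, 4 * w k ≤ 1 := by
        have := h.tendsto_zero.const_mul 4
        rw [mul_zero] at this
        exact this.eventually_le_const one_pos
      have hexp : ∀ᶠ k : ℕ in atTop, 1 + 1 / ((k : ℝ) + 1) ≤ d' := by
        have := (tendsto_one_div_add_atTop_nhds_zero_nat (𝕜 := ℝ)).const_add 1
        rw [add_zero] at this
        exact this.eventually_le_const hlt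
      refine tendsto_of_tendsto_of_tendsto_of_le_of_le' tendsto_const_nhds hg
        (Eventually.of_forall fun _ ↦ zero_le) ?_
      filter_upwards [eventually_forall_ge_atTop.2 hw4, eventually_forall_ge_atTop.2 hexp]
        with k hk4 hkd
      have hterm (n : ℕ) (hn : k ≤ n) (c : E) : ediam (closedBall c (2 * w n)) ^ (d' : ℝ) ≤
          ENNReal.ofReal ((4 * w n) ^ (1 + 1 / ((n : ℝ) + 1))) := by
        have hw := h.pos n
        calc _ ≤ ENNReal.ofReal (4 * w n) ^ (d' : ℝ) := by
              gcongr; exact hdiam n c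
          _ = ENNReal.ofReal ((4 * w n) ^ (d' : ℝ)) :=
            ENNReal.ofReal_rpow_of_nonneg (by positivity) (by positivity)
          _ ≤ _ := ENNReal.ofReal_le_ofReal
            (Real.rpow_le_rpow_of_exponent_ge (by positivity) (hk4 n hn) (hkd n hn))
      rw [Fintype.sum_sigma]
      calc _ ≤ ∑ n : {n // n ∈ Finset.Icc k (2 * k)}, ENNReal.ofReal ((1 / 2) ^ k) := by
            refine Finset.sum_le_sum fun n _ ↦ ?_
            have hn := (Finset.mem_Icc.1 n.2).1
            calc _ ≤ ∑ c : {c // c ∈ C n.1},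
                    ENNReal.ofReal ((4 * w n) ^ (1 + 1 / ((n.1 : ℝ) + 1))) :=
                  Finset.sum_le_sum fun c _ ↦ hterm n.1 hn c.1
              _ = ENNReal.ofReal ((C n.1).card * (4 * w n) ^ (1 + 1 / ((n.1 : ℝ) + 1))) := by
                  rw [Finset.sum_const, Finset.card_univ, Fintype.card_coe, nsmul_eq_mul,
                    ENNReal.ofReal_mul (by positivity), ENNReal.ofReal_natCast]
              _ ≤ _ := ENNReal.ofReal_le_ofReal ((h.card_mul_le n.1).trans
                  (pow_le_pow_of_le_one (by norm_num) (by norm_num) hn))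
        _ = _ := by
            rw [Finset.sum_const, Finset.card_univ, Fintype.card_coe, Nat.card_Icc, nsmul_eq_mul,
              ENNReal.ofReal_mul (by positivity), show 2 * k + 1 - k = k + 1 by omega]
            norm_cast
    rw [hlim.liminf_eq, nonpos_iff_eq_zero] at key
    simp [key] at hd'
  · exact ENNReal.ofReal_le_ofReal
      (by linarith [h.anti (Finset.mem_Icc.1 i.1.2).1])
  · obtain ⟨n, hn1, hn2, hn3⟩ := mem_windowSet.1 hx k
    have hn2' : n ≤ 2 * k := by exact_mod_cast (by linarith : (n : ℝ) ≤ 2 * k)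
    have hw := h.pos n
    have h1 : segmentNet (F n) ⊆ cthickening (w n) (C n : Set E) := by
      refine (h.subset_cover n).trans (iUnion₂_subset fun c hc y hy ↦ ?_)
      exact mem_cthickening_of_dist_le y c _ _ hc hy
    rw [one_mul] at hn3
    have h2 := cthickening_cthickening_subset hw.le hw.le _ (cthickening_subset_of_subset _ h1 hn3)
    rw [← two_mul, (C n).finite_toSet.isCompact.cthickening_eq_biUnion_closedBall (by positivity)]
      at h2
    obtain ⟨c, hc, hxc⟩ := mem_iUnion₂.1 h2
    exact mem_iUnion.2 ⟨⟨⟨n, Finset.mem_Icc.2 ⟨hn1, hn2'⟩⟩, ⟨c, hc⟩⟩, hxc⟩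

end Nets

section Main
variable {E : Type*} [NormedAddCommGroup E] [InnerProductSpace ℝ E]
  {F : ℕ → Finset E} {w : ℕ → ℝ} {C : ℕ → Finset E}

open Filter Topology

theorem IsNetSequence.hasBrokenLines (h : IsNetSequence F w C) :
    HasBrokenLines (windowSet (fun n ↦ segmentNet (F n)) w) := by
  intro l l' hl hll hl' x hx ζ₀ hζ₀
  obtain ⟨ζ, hζ, hζ1, hζζ⟩ : ∃ ζ : ℝ, 0 < ζ ∧ ζ ≤ 1 ∧ ζ ≤ ζ₀ :=
    ⟨min ζ₀ 1, by positivity, min_le_right _ _, min_le_left _ _⟩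
  have hκ : 0 < l' - l := by linarith
  obtain ⟨m₀, hm₀⟩ := exists_nat_ge (max (‖x‖ + 2) (max (3 / ((l' - l) * ζ)) (2 / (l' - l))))
  simp only [max_le_iff] at hm₀
  obtain ⟨hma, hmb, hmc⟩ := hm₀
  rw [div_le_iff₀ (by positivity)] at hmb hmc
  have hw0 := h.pos m₀
  refine ⟨(l' - l) * w m₀ / 3, by positivity, fun s hs hs₀ p₁ hp₁ p₂ hp₂ p₃ hp₃ ↦ ?_⟩
  have hex : ∃ m, (l' - l) * w m < 3 * s := by
    have := h.tendsto_zero.const_mul (l' - l)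
    rw [mul_zero] at this
    exact (this.eventually_lt_const (by linarith : 0 < 3 * s)).exists
  classical
  set m := Nat.find hex with hm
  have hmlt : (l' - l) * w m < 3 * s := Nat.find_spec hex
  have hmin (n : ℕ) (hn : n < m) : 3 * s ≤ (l' - l) * w n := not_lt.1 (Nat.find_min hex hn)
  have hmm : m₀ < m := by
    by_contra! hc
    have := mul_le_mul_of_nonneg_left (h.anti hc) hκ.le
    linarith
  have hmm' : (m₀ : ℝ) < m := by exact_mod_cast hmm
  have hs1 : s ≤ 1 := by
    have h1 : w m₀ ≤ 1 := (h.le_pow m₀).trans (pow_le_one₀ (by norm_num) (by norm_num))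
    nlinarith
  have hq (p : E) (hp : p ∈ closedBall x (2 * s)) :
      ∃ q ∈ F (m + 1), ‖q - p‖ ≤ ζ * s ∧ q ∈ closedBall x (3 * s) := by
    rw [mem_closedBall, dist_eq_norm] at hp
    obtain ⟨q, hqF, hqp⟩ := h.exists_near m p (by
      have := norm_le_norm_add_norm_sub' p x
      linarith)
    have hqs : ‖q - p‖ ≤ ζ * s := by
      refine hqp.trans ?_
      rw [div_le_iff₀ (by positivity)]
      have : (l' - l) * w m ≤ (l' - l) * (ζ * s * (m + 1)) := by
        have : 3 ≤ m * ((l' - l) * ζ) := hmb.trans (by gcongr)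
        nlinarith [mul_pos (mul_pos hκ hζ) hs]
      exact le_of_mul_le_mul_left this hκ
    refine ⟨q, hqF, hqs, ?_⟩
    rw [mem_closedBall, dist_eq_norm]
    have := norm_sub_le_norm_sub_add_norm_sub q p x
    nlinarith
  have hseg {a b : E} (ha : a ∈ F (m + 1)) (ha' : a ∈ closedBall x (3 * s)) (hb : b ∈ F (m + 1))
      (hb' : b ∈ closedBall x (3 * s)) :
      segment ℝ a b ⊆ windowSet (fun n ↦ segmentNet (F n)) w l' := fun y hy ↦
    h.mem_windowSet_of_near hl (by positivity) hmin
      (by nlinarith) hl'.le hx ((convex_closedBall x (3 * s)).segment_subset ha' hb' hy)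
      fun n hn ↦ segment_subset_segmentNet (h.mono hn ha) (h.mono hn hb) hy
  obtain ⟨q₁, h1, h1', h1b⟩ := hq p₁ hp₁
  obtain ⟨q₂, h2, h2', h2b⟩ := hq p₂ hp₂
  obtain ⟨q₃, h3, h3', h3b⟩ := hq p₃ hp₃
  have hζs : ζ * s ≤ ζ₀ * s := by gcongr
  exact ⟨q₁, q₂, q₃, h1'.trans hζs, h2'.trans hζs, h3'.trans hζs, hseg h1 h1b h2 h2b,
    hseg h2 h2b h3 h3b⟩

theorem exists_isCompact_dimH_eq_one_differentiableAt [FiniteDimensional ℝ E] [Nontrivial E] :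
    ∃ S : Set E, IsCompact S ∧ dimH S = 1 ∧ ∀ g : E → ℝ, (∃ K : ℝ≥0, LipschitzWith K g) →
      (∃ x ∈ S, DifferentiableAt ℝ g x) ∧ S ⊆ closure {x ∈ S | DifferentiableAt ℝ g x} := by
  classical
  let _ : MeasurableSpace E := borel E
  have : BorelSpace E := ⟨rfl⟩
  have : ProperSpace E := FiniteDimensional.proper_real E
  have : CompleteSpace E := FiniteDimensional.complete ℝ E
  obtain ⟨a, b, hab⟩ := exists_pair_ne E
  obtain ⟨F, w, C, hF, h⟩ := exists_isNetSequence ({a, b} : Finset E)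
  set T := windowSet (fun n ↦ segmentNet (F n)) w with hT
  set U : Set E := {x | ∃ l, 0 < l ∧ l < 1 ∧ x ∈ T l} with hU
  have hsub : segment ℝ a b ⊆ U := fun x hx ↦ ⟨1 / 2, by norm_num, by norm_num,
    subset_windowSet (fun n ↦ segment_subset_segmentNet (h.mono (zero_le) (by simp [hF]))
      (h.mono (zero_le) (by simp [hF]))) w (by norm_num) hx⟩
  have hU1 : closure U ⊆ T 1 := closure_minimal
    (fun x ⟨l, _, hl, hx⟩ ↦ windowSet_mono h.pos hl.le hx) (isClosed_windowSet _ _ _)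
  refine ⟨closure U, (isBounded_windowSet (isBounded_segmentNet _) w 1 |>.subset
    (subset_closure.trans hU1)).isCompact_closure, le_antisymm ?_ ?_, ?_⟩
  · exact (dimH_mono hU1).trans h.dimH_windowSet_le
  · exact (Real.dimH_segment hab).symm.le.trans (dimH_mono (hsub.trans subset_closure))
  rintro g ⟨K, hg⟩
  have hK : (0 : ℝ) < K + 1 := by positivity
  have hf : LipschitzWith 1 fun x ↦ ((K : ℝ) + 1)⁻¹ * g x := by
    refine LipschitzWith.of_dist_le_mul fun x y ↦ ?_
    rw [Real.dist_eq, ← mul_sub, abs_mul, abs_of_pos (by positivity), ← Real.dist_eq,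
      NNReal.coe_one, one_mul, inv_mul_le_iff₀ hK]
    refine (hg.dist_le_mul x y).trans ?_
    gcongr
    linarith
  have hdiff {x : E} (hx : DifferentiableAt ℝ (fun x ↦ ((K : ℝ) + 1)⁻¹ * g x) x) :
      DifferentiableAt ℝ g x := by
    have := hx.const_mul ((K : ℝ) + 1)
    simpa [mul_inv_cancel_left₀ hK.ne'] using this
  have hnear : U ⊆ closure {x ∈ closure U | DifferentiableAt ℝ g x} := by
    rintro x ⟨l, hl0, hl1, hx⟩
    refine Metric.mem_closure_iff.2 fun r hr ↦ ?_
    obtain ⟨x', l', hl0', hl1', hx', hxr, hd⟩ := h.hasBrokenLines.exists_differentiableAt_near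
      (fun l _ _ ↦ isClosed_windowSet _ _ _) (fun l l' _ hl _ ↦ windowSet_mono h.pos hl) hf
      hl0 hl1 hx hr
    exact ⟨x', ⟨subset_closure ⟨l', hl0', hl1', hx'⟩, hdiff hd⟩,
      by rwa [dist_comm, dist_eq_norm]⟩
  refine ⟨?_, closure_minimal hnear isClosed_closure⟩
  have hne : (closure {x ∈ closure U | DifferentiableAt ℝ g x}).Nonempty :=
    ⟨a, hnear (hsub (left_mem_segment ℝ a b))⟩
  exact closure_nonempty_iff.1 hne

end Main

end

theorem stmt10 (d : ℕ) (hd : 1 ≤ d) :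
    ∃ S : Set (EuclideanSpace ℝ (Fin d)), IsCompact S ∧ dimH S = 1 ∧
      ∀ g : EuclideanSpace ℝ (Fin d) → ℝ, (∃ K : NNReal, LipschitzWith K g) →
        (∃ x ∈ S, DifferentiableAt ℝ g x) ∧
        S ⊆ closure {x ∈ S | DifferentiableAt ℝ g x} := by
  have : Nonempty (Fin d) := ⟨⟨0, hd⟩⟩
  exact exists_isCompact_dimH_eq_one_differentiableAt
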